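/- arXiv:2204.06284 — 3 statements merged into one kernel-verified Lean document; each statement's English description precedes it below -/
import Mathlib

section
/- Let ℓ ≥ 2 be an integer, let G be a graph in 𝒢_ℓ, and let S be a nonempty subset of V(G) such that the induced subgraph G[S] is connected. For each integer i ≥ 0 let L_i(S) = {v ∈ V(G) : d(v, S) = i}, where d(v, S) = min{d(v, s) : s ∈ S} is the graph distance from v to S. If the induced subgraph G[L_i(S)] is bipartite for each i ∈ {1, …, ⌊ℓ/2⌋}, then G[L_i(S)] is bipartite for every integer i > 0. -/
open SimpleGraph

/-- A *hole* of length `n` in `G`: an induced cycle of length `n ≥ 4`. -/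
def SimpleGraph.HasHole {V : Type*} (G : SimpleGraph V) (n : ℕ) : Prop :=
  4 ≤ n ∧ ∃ (v : V) (w : G.Walk v v), w.IsCycle ∧ w.toSubgraph.IsInduced ∧ w.length = n

/-- `G ∈ 𝒢_ℓ`: `G` has girth `2ℓ+1` and no odd hole of length at least `2ℓ+3`. -/
def SimpleGraph.MemGFamily {V : Type*} (G : SimpleGraph V) (l : ℕ) : Prop :=
  G.egirth = (2 * l + 1 : ℕ) ∧ ∀ n : ℕ, Odd n → 2 * l + 3 ≤ n → ¬ G.HasHole n

/-- The set of vertices at distance exactly `i` from the vertex set `S`. -/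
def levelSet {V : Type*} (G : SimpleGraph V) (S : Set V) (i : ℕ) : Set V :=
  {v : V | (⨅ s ∈ S, G.edist v s) = (i : ℕ∞)}

namespace Aux

variable {V : Type*} {G : SimpleGraph V}

lemma walk_of_fun (n : ℕ) : ∀ (f : ℕ → V), (∀ t < n, G.Adj (f t) (f (t+1))) →
    ∃ w : G.Walk (f 0) (f n), w.length = n ∧ ∀ t ≤ n, w.getVert t = f t := by
  induction n with
  | zero => intro f _; exact ⟨.nil, rfl, by intro t ht; obtain rfl : t = 0 := by omega
                                            simp⟩
  | succ n ih =>
    intro f hf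
    obtain ⟨w, hw, hg⟩ := ih (fun t => f (t+1)) (fun t ht => hf (t+1) (by omega))
    refine ⟨.cons (hf 0 (by omega)) w, by simp [hw], ?_⟩
    intro t ht
    cases t with
    | zero => simp
    | succ t => simpa using hg t (by omega)

lemma cyc_of_fun (n : ℕ) (hn : 3 ≤ n) (f : ℕ → V) (hf : ∀ t < n, G.Adj (f t) (f (t+1)))
    (h0 : f n = f 0) (hinj : ∀ i j, i < j → j < n → f i ≠ f j) :
    ∃ w : G.Walk (f 0) (f 0), w.IsCycle ∧ w.length = n ∧ ∀ t ≤ n, w.getVert t = f t := by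
  obtain ⟨n, rfl⟩ : ∃ k, n = k + 1 := ⟨n - 1, by omega⟩
  obtain ⟨w, hw, hg⟩ : ∃ w : G.Walk (f 1) (f 0), w.length = n ∧ ∀ t ≤ n, w.getVert t = f (t+1) := by
    rw [← h0]
    exact walk_of_fun n (fun t => f (t+1)) (fun t ht => hf (t+1) (by omega))
  have hinj' : ∀ i j, i ≤ n → j ≤ n → f (i+1) = f (j+1) → i = j := by
    have key : ∀ i j, i < j → j ≤ n → f (i+1) ≠ f (j+1) := by
      intro i j hij hj h
      by_cases hjn : j = n
      · subst hjn; rw [h0] at h; exact hinj 0 (i+1) (by omega) (by omega) h.symm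
      · exact hinj (i+1) (j+1) (by omega) (by omega) h
    intro i j hi hj h
    rcases lt_trichotomy i j with h1 | h1 | h1
    · exact absurd h (key i j h1 hj)
    · exact h1
    · exact absurd h.symm (key j i h1 hi)
  have hp : w.IsPath := by
    rw [← Walk.IsPath.getVert_injOn_iff]
    intro i hi j hj h
    simp only [Set.mem_ofPred_eq, hw] at hi hj
    rw [hg i hi, hg j hj] at h
    exact hinj' i j hi hj h
  have hc : (Walk.cons (hf 0 (by omega)) w).IsCycle := by
    rw [Walk.cons_isCycle_iff]
    refine ⟨hp, ?_⟩
    intro hmem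
    rw [← Walk.adj_toSubgraph_iff_mem_edges, Walk.toSubgraph_adj_iff] at hmem
    obtain ⟨i, hi, hlt⟩ := hmem
    rw [hw] at hlt
    rw [hg i (by omega), hg (i+1) (by omega)] at hi
    rw [← h0] at hi
    simp only [Sym2.eq_iff] at hi
    rcases hi with ⟨h1, _⟩ | ⟨h1, h2⟩
    · have := hinj' i n (by omega) (by omega) h1; omega
    · have := hinj' i 0 (by omega) (by omega) h1
      have := hinj' (i+1) n (by omega) (by omega) h2; omega
  refine ⟨_, hc, by simp [hw], ?_⟩
  intro t ht
  cases t with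
  | zero => simp
  | succ t => simpa using hg t (by omega)

/-- girth lemma for non-backtracking closed sequences -/
lemma girth_nb {g : ℕ} (hg : G.egirth = (g : ℕ)) (n : ℕ) (hn : 1 ≤ n) (f : ℕ → V)
    (hf : ∀ t < n, G.Adj (f t) (f (t+1))) (hnb : ∀ t, t + 2 ≤ n → f t ≠ f (t+2))
    (h0 : f 0 = f n) : g ≤ n := by
  classical
  have hex : ∃ d, 1 ≤ d ∧ ∃ i, i + d ≤ n ∧ f i = f (i + d) := ⟨n, hn, 0, by omega, by simpa using h0⟩
  let d := Nat.find hex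
  obtain ⟨hd, i, hi, he⟩ : 1 ≤ d ∧ ∃ i, i + d ≤ n ∧ f i = f (i + d) := Nat.find_spec hex
  have hmin : ∀ e, 1 ≤ e → e < d → ∀ j, j + e ≤ n → f j ≠ f (j + e) := by
    intro e he1 he2 j hj h
    exact Nat.find_min hex he2 ⟨he1, j, hj, h⟩
  have hd3 : 3 ≤ d := by
    by_contra hlt
    have : d = 1 ∨ d = 2 := by omega
    rcases this with h | h
    · rw [h] at he hi
      exact (hf i (by omega)).ne he
    · rw [h] at he hi
      exact hnb i (by omega) he
  obtain ⟨w, hc, hl, _⟩ := cyc_of_fun d hd3 (fun t => f (i + t)) (fun t ht => hf (i+t) (by omega))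
    he.symm (by
      intro a b hab hb h
      refine hmin (b - a) (by omega) (by omega) (i + a) (by omega) ?_
      rw [show i + a + (b - a) = i + b by omega]; exact h)
  have := egirth_le_length hc
  rw [hg, hl] at this
  have : g ≤ d := by exact_mod_cast this
  omega

/-- closing up with an edge -/
lemma girth_nb_edge {g : ℕ} (hg : G.egirth = (g : ℕ)) (n : ℕ) (hn : 1 ≤ n) (f : ℕ → V)
    (hf : ∀ t < n, G.Adj (f t) (f (t+1))) (hnb : ∀ t, t + 2 ≤ n → f t ≠ f (t+2))
    (h0 : G.Adj (f n) (f 0)) (h1 : f (n-1) ≠ f 0) : g ≤ n + 1 := by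
  refine girth_nb hg (n+1) (by omega) (fun t => if t ≤ n then f t else f 0) ?_ ?_ ?_
  · intro t ht
    by_cases h : t = n
    · subst h; simpa using h0
    · have a1 : t ≤ n := by omega
      have a2 : t + 1 ≤ n := by omega
      simpa [a1, a2] using hf t (by omega)
  · intro t ht
    have a1 : t ≤ n := by omega
    by_cases h : t + 1 = n
    · have a2 : ¬ (t + 2 ≤ n) := by omega
      obtain rfl : t = n - 1 := by omega
      simpa [a1, a2] using h1
    · have a2 : t + 2 ≤ n := by omega
      simpa [a1, a2] using hnb t (by omega)
  · simp

/-- closing up with a path of length two -/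
lemma girth_nb_two {g : ℕ} (hg : G.egirth = (g : ℕ)) (n : ℕ) (hn : 1 ≤ n) (f : ℕ → V)
    (hf : ∀ t < n, G.Adj (f t) (f (t+1))) (hnb : ∀ t, t + 2 ≤ n → f t ≠ f (t+2)) (c : V)
    (h0 : G.Adj (f n) c) (h2 : G.Adj c (f 0)) (h1 : f (n-1) ≠ c) (h3 : f n ≠ f 0) :
    g ≤ n + 2 := by
  refine girth_nb_edge hg (n+1) (by omega) (fun t => if t ≤ n then f t else c) ?_ ?_ ?_ ?_
  · intro t ht
    by_cases h : t = n
    · subst h; simpa using h0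
    · have a1 : t ≤ n := by omega
      have a2 : t + 1 ≤ n := by omega
      simpa [a1, a2] using hf t (by omega)
  · intro t ht
    have a1 : t ≤ n := by omega
    by_cases h : t + 1 = n
    · have a2 : ¬ (t + 2 ≤ n) := by omega
      obtain rfl : t = n - 1 := by omega
      simpa [a1, a2] using h1
    · have a2 : t + 2 ≤ n := by omega
      simpa [a1, a2] using hnb t (by omega)
  · simpa using h2
  · simpa using h3

lemma four_cycle {g : ℕ} (hg : G.egirth = (g : ℕ)) (hg5 : 5 ≤ g) {a b c d : V}
    (h1 : G.Adj a b) (h2 : G.Adj b c) (h3 : G.Adj c d) (h4 : G.Adj d a) (hac : a ≠ c) :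
    b = d := by
  by_contra hbd
  have := girth_nb_two hg 2 (by omega) (fun t => if t = 0 then a else if t = 1 then b else c)
    (by intro t ht
        have : t = 0 ∨ t = 1 := by omega
        rcases this with rfl | rfl <;> simpa)
    (by intro t ht
        obtain rfl : t = 0 := by omega
        simpa) d (by simpa) (by simpa) (by simpa) (by simpa using hac.symm)
  omega

/-- induced cycle as a function -/
def IndC (G : SimpleGraph V) (n : ℕ) (f : ℕ → V) : Prop :=
  ∀ i j, i < j → j < n → f i ≠ f j ∧ (G.Adj (f i) (f j) ↔ j = i + 1 ∨ (i = 0 ∧ j = n - 1))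

/-- induced path as a function -/
def IndP (G : SimpleGraph V) (m : ℕ) (q : ℕ → V) : Prop :=
  ∀ i j, i < j → j ≤ m → q i ≠ q j ∧ (G.Adj (q i) (q j) ↔ j = i + 1)

lemma IndC.cycle {n : ℕ} {f : ℕ → V} (hn : 3 ≤ n) (h : IndC G n f) :
    ∃ (u : V) (w : G.Walk u u), w.IsCycle ∧ w.toSubgraph.IsInduced ∧ w.length = n := by
  set f' : ℕ → V := fun t => if t < n then f t else f 0 with hf'
  have e1 : ∀ t, t < n → f' t = f t := by intro t ht; simp [hf', ht]
  have e2 : f' n = f 0 := by simp [hf']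
  obtain ⟨w, hc, hl, hgv⟩ := cyc_of_fun (G := G) n hn f' (by
      intro t ht
      by_cases h' : t = n - 1
      · rw [e1 t ht, show t + 1 = n by omega, e2, h']
        exact ((h 0 (n-1) (by omega) (by omega)).2.2 (Or.inr ⟨rfl, rfl⟩)).symm
      · rw [e1 t ht, e1 (t+1) (by omega)]
        exact (h t (t+1) (by omega) (by omega)).2.2 (Or.inl rfl))
    (by rw [e2, e1 0 (by omega)])
    (by intro i j hij hj; rw [e1 i (by omega), e1 j hj]; exact (h i j hij hj).1)
  refine ⟨_, w, hc, ?_, hl⟩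
  have hsup : ∀ x ∈ w.support, ∃ t < n, f t = x := by
    intro x hx
    obtain ⟨t, ht, hle⟩ := Walk.mem_support_iff_exists_getVert.1 hx
    rw [hl] at hle
    rw [hgv t hle] at ht
    by_cases h' : t = n
    · exact ⟨0, by omega, by rw [← ht, h', e2]⟩
    · exact ⟨t, by omega, by rw [← ht, e1 t (by omega)]⟩
  have key : ∀ i j, i < j → j < n → G.Adj (f i) (f j) → w.toSubgraph.Adj (f i) (f j) := by
    intro i j hij hj hadj
    rcases (h i j hij hj).2.1 hadj with h1 | ⟨h1, h2⟩
    · have := w.toSubgraph_adj_getVert (i := i) (by omega)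
      rwa [hgv i (by omega), hgv (i+1) (by omega), e1 i (by omega), e1 (i+1) (by omega), ← h1] at this
    · have := w.toSubgraph_adj_getVert (i := n-1) (by omega)
      rw [hgv (n-1) (by omega), hgv (n-1+1) (by omega), e1 (n-1) (by omega),
        show n - 1 + 1 = n by omega, e2] at this
      rw [h1, h2]; exact this.symm
  intro x hx y hy hadj
  rw [Walk.mem_verts_toSubgraph] at hx hy
  obtain ⟨i, hi, rfl⟩ := hsup x hx
  obtain ⟨j, hj, rfl⟩ := hsup y hy
  rcases lt_trichotomy i j with h1 | h1 | h1
  · exact key i j h1 hj hadj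
  · subst h1; exact absurd rfl hadj.ne
  · exact (key j i h1 hi hadj.symm).symm

lemma IndC.length_eq {l n : ℕ} {f : ℕ → V} (hl : 2 ≤ l) (hG : G.MemGFamily l) (hn : 3 ≤ n)
    (hodd : Odd n) (h : IndC G n f) : n = 2 * l + 1 := by
  obtain ⟨u, w, hc, hi, hw⟩ := h.cycle hn
  have := egirth_le_length hc
  rw [hG.1, hw] at this
  have h1 : 2 * l + 1 ≤ n := by exact_mod_cast this
  by_contra hne
  have : 2 * l + 3 ≤ n := by
    obtain ⟨k, rfl⟩ := hodd; omega
  exact hG.2 n hodd this ⟨by omega, u, w, hc, hi, hw⟩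

lemma glue {L M : ℕ} {F Q : ℕ → V} (hF : IndP G L F) (hQ : IndP G M Q) (hL : 2 ≤ L) (hM : 2 ≤ M)
    (h0 : F 0 = Q 0) (h1 : F L = Q M)
    (hd : ∀ s t, 0 < s → s < L → 0 < t → t < M → F s ≠ Q t ∧ ¬ G.Adj (F s) (Q t)) :
    IndC G (L + M) (fun t => if t ≤ L then F t else Q (L + M - t)) := by
  intro i j hij hj
  by_cases hi : i ≤ L
  · by_cases hjL : j ≤ L
    · simp only [hi, hjL, if_true]
      refine ⟨(hF i j hij hjL).1, (hF i j hij hjL).2.trans ?_⟩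
      omega
    · simp only [hi, hjL, if_true, if_false]
      by_cases hi0 : i = 0
      · subst hi0
        rw [h0]
        refine ⟨(hQ 0 (L + M - j) (by omega) (by omega)).1,
          (hQ 0 (L + M - j) (by omega) (by omega)).2.trans ?_⟩
        omega
      by_cases hiL : i = L
      · subst hiL
        rw [h1, ne_comm, G.adj_comm]
        refine ⟨(hQ (i + M - j) M (by omega) (by omega)).1,
          (hQ (i + M - j) M (by omega) (by omega)).2.trans ?_⟩
        omega
      have := hd i (L + M - j) (by omega) (by omega) (by omega) (by omega)
      refine ⟨this.1, iff_of_false this.2 (by omega)⟩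
  · have hjL : ¬ j ≤ L := by omega
    simp only [hi, hjL, if_false]
    rw [ne_comm, G.adj_comm]
    refine ⟨(hQ (L + M - j) (L + M - i) (by omega) (by omega)).1,
      (hQ (L + M - j) (L + M - i) (by omega) (by omega)).2.trans ?_⟩
    omega

end Aux

namespace Aux

variable {V : Type*} {G : SimpleGraph V}

lemma odd_ind_cycle (T : Set V) (h : ¬ (G.induce T).Colorable 2) :
    ∃ (n : ℕ) (f : ℕ → V), Odd n ∧ 3 ≤ n ∧ IndC G n f ∧ ∀ t, f t ∈ T := by
  classical
  rw [two_colorable_iff_forall_loop_even] at h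
  push Not at h
  obtain ⟨u, w, hw⟩ := h
  rw [Nat.not_even_iff_odd] at hw
  have hex : ∃ n, Odd n ∧ ∃ f : ℕ → V, f 0 = f n ∧ (∀ t < n, G.Adj (f t) (f (t+1))) ∧
      ∀ t, f t ∈ T := by
    refine ⟨w.length, hw, fun t => (w.getVert t : V), by simp, ?_, fun t => (w.getVert t).2⟩
    intro t ht
    exact w.adj_getVert_succ ht
  let n := Nat.find hex
  obtain ⟨hodd, f, h0, hf, hT⟩ : Odd n ∧ ∃ f : ℕ → V, f 0 = f n ∧
    (∀ t < n, G.Adj (f t) (f (t+1))) ∧ ∀ t, f t ∈ T := Nat.find_spec hex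
  have hmin : ∀ m, Odd m → m < n → ∀ f : ℕ → V, f 0 = f m → (∀ t < m, G.Adj (f t) (f (t+1))) →
      (∀ t, f t ∈ T) → False := by
    intro m hm hlt f h1 h2 h3
    exact Nat.find_min hex hlt ⟨hm, f, h1, h2, h3⟩
  have hn3 : 3 ≤ n := by
    by_contra hlt
    have : n = 1 := by
      obtain ⟨k, hk⟩ := hodd; omega
    rw [this] at h0
    exact (hf 0 (by omega)).ne h0
  refine ⟨n, f, hodd, hn3, ?_, hT⟩
  intro i j hij hj
  constructor
  · intro he
    have hcase : Odd (j - i) ∨ Odd (n - (j - i)) := by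
      by_contra hc
      simp only [not_or, Nat.not_odd_iff_even] at hc
      obtain ⟨⟨a, ha⟩, ⟨b, hb⟩⟩ := hc
      obtain ⟨k, hk⟩ := hodd
      omega
    rcases hcase with ho | ho
    · refine hmin _ ho (by omega) (fun t => f (i + t)) ?_ ?_ (fun t => hT _)
      · simp only [Nat.add_zero]; rw [show i + (j - i) = j by omega]; exact he
      · intro t ht; exact hf (i+t) (by omega)
    · refine hmin _ ho (by omega) (fun t => if t ≤ i then f t else f (t + (j - i))) ?_ ?_ ?_
      · have a1 : ¬ (n - (j - i) ≤ i) := by omega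
        simp only [Nat.zero_le, if_true, a1, if_false]
        rw [show n - (j - i) + (j - i) = n by omega]; exact h0
      · intro t ht
        by_cases h1 : t + 1 ≤ i
        · have h2 : t ≤ i := by omega
          simp only [h1, h2, if_true]; exact hf t (by omega)
        · by_cases h2 : t ≤ i
          · obtain rfl : t = i := by omega
            simp only [h1, le_refl, if_true, if_false]
            rw [he, show t + 1 + (j - t) = j + 1 by omega]
            exact hf j hj
          · simp only [h1, h2, if_false]
            rw [show t + 1 + (j - i) = t + (j - i) + 1 by omega]
            exact hf _ (by omega)
      · intro t; split_ifs <;> exact hT _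
  constructor
  · intro hadj
    by_contra hne
    have hcase : Odd (j - i + 1) ∨ Odd (n - (j - i) + 1) := by
      by_contra hc
      simp only [not_or, Nat.not_odd_iff_even] at hc
      obtain ⟨⟨a, ha⟩, ⟨b, hb⟩⟩ := hc
      obtain ⟨k, hk⟩ := hodd
      omega
    rcases hcase with ho | ho
    · refine hmin _ ho (by omega) (fun t => if t ≤ j - i then f (i + t) else f i) ?_ ?_ ?_
      · simp
      · intro t ht
        by_cases h1 : t + 1 ≤ j - i
        · have h2 : t ≤ j - i := by omega
          simp only [h1, h2, if_true]; exact hf (i + t) (by omega)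
        · have h2 : t ≤ j - i := by omega
          simp only [h1, h2, if_true, if_false]
          rw [show i + t = j by omega]; exact hadj.symm
      · intro t; split_ifs <;> exact hT _
    · refine hmin _ ho (by omega) (fun t => if t ≤ i then f t else f (t + (j - i) - 1)) ?_ ?_ ?_
      · have a1 : ¬ (n - (j - i) + 1 ≤ i) := by omega
        simp only [Nat.zero_le, if_true, a1, if_false]
        rw [show n - (j - i) + 1 + (j - i) - 1 = n by omega]; exact h0
      · intro t ht
        by_cases h1 : t + 1 ≤ i
        · have h2 : t ≤ i := by omega
          simp only [h1, h2, if_true]; exact hf t (by omega)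
        · by_cases h2 : t ≤ i
          · obtain rfl : t = i := by omega
            simp only [h1, le_refl, if_true, if_false]
            rw [show t + 1 + (j - t) - 1 = j by omega]
            exact hadj
          · simp only [h1, h2, if_false]
            rw [show t + 1 + (j - i) - 1 = t + (j - i) - 1 + 1 by omega]
            exact hf _ (by omega)
      · intro t; split_ifs <;> exact hT _
  · rintro (rfl | ⟨rfl, rfl⟩)
    · exact hf i (by omega)
    · have := hf (n-1) (by omega)
      rw [show n - 1 + 1 = n by omega, ← h0] at this
      exact this.symm

lemma periodic_cycle {n : ℕ} (hn : 3 ≤ n) {f : ℕ → V} (h : IndC G n f) :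
    ∀ j k, j < k → k < j + n →
      f (j % n) ≠ f (k % n) ∧ (G.Adj (f (j % n)) (f (k % n)) ↔ k = j + 1 ∨ k = j + n - 1) := by
  intro j k hjk hk
  obtain ⟨d, rfl⟩ : ∃ d, k = j + d := ⟨k - j, by omega⟩
  have ha : j % n < n := Nat.mod_lt _ (by omega)
  have hd : d % n = d := Nat.mod_eq_of_lt (by omega)
  rw [Nat.add_mod, hd]
  by_cases hc : j % n + d < n
  · rw [Nat.mod_eq_of_lt hc]
    refine ⟨(h _ _ (by omega) hc).1, (h _ _ (by omega) hc).2.trans ?_⟩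
    omega
  · have hm : (j % n + d) % n = j % n + d - n := by
      rw [Nat.mod_eq_sub_mod (by omega), Nat.mod_eq_of_lt (by omega)]
    rw [hm, ne_comm, G.adj_comm]
    refine ⟨(h _ _ (by omega) (by omega)).1, (h _ _ (by omega) (by omega)).2.trans ?_⟩
    omega

lemma shortest {T : Set V} {x y : V} (w : G.Walk x y) (hw : ∀ z ∈ w.support, z ∈ T) :
    ∃ (m : ℕ) (q : ℕ → V), q 0 = x ∧ q m = y ∧ IndP G m q ∧ ∀ t ≤ m, q t ∈ T := by
  classical
  have hex : ∃ m, ∃ q : ℕ → V, q 0 = x ∧ q m = y ∧ (∀ t < m, G.Adj (q t) (q (t+1))) ∧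
      ∀ t ≤ m, q t ∈ T :=
    ⟨w.length, w.getVert, by simp, by simp, fun t ht => w.adj_getVert_succ ht,
      fun t ht => hw _ (w.getVert_mem_support t)⟩
  let m := Nat.find hex
  obtain ⟨q, h0, h1, hq, hT⟩ : ∃ q : ℕ → V, q 0 = x ∧ q m = y ∧
    (∀ t < m, G.Adj (q t) (q (t+1))) ∧ ∀ t ≤ m, q t ∈ T := Nat.find_spec hex
  have hmin : ∀ k, k < m → ∀ q : ℕ → V, q 0 = x → q k = y → (∀ t < k, G.Adj (q t) (q (t+1))) →
      (∀ t ≤ k, q t ∈ T) → False := fun k hk q a b c d => Nat.find_min hex hk ⟨q, a, b, c, d⟩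
  refine ⟨m, q, h0, h1, ?_, hT⟩
  intro i j hij hj
  constructor
  · intro he
    refine hmin (m - (j - i)) (by omega) (fun t => if t ≤ i then q t else q (t + (j - i))) ?_ ?_ ?_ ?_
    · simpa using h0
    · by_cases hjm : j = m
      · have a1 : m - (j - i) ≤ i := by omega
        simp only [a1, if_true]
        rw [show m - (j - i) = i by omega, he, hjm]; exact h1
      · have a1 : ¬ (m - (j - i) ≤ i) := by omega
        simp only [a1, if_false]
        rw [show m - (j - i) + (j - i) = m by omega]; exact h1
    · intro t ht
      by_cases h1 : t + 1 ≤ i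
      · have h2 : t ≤ i := by omega
        simp only [h1, h2, if_true]; exact hq t (by omega)
      · by_cases h2 : t ≤ i
        · obtain rfl : t = i := by omega
          simp only [h1, le_refl, if_true, if_false]
          rw [he, show t + 1 + (j - t) = j + 1 by omega]
          exact hq j (by omega)
        · simp only [h1, h2, if_false]
          rw [show t + 1 + (j - i) = t + (j - i) + 1 by omega]
          exact hq _ (by omega)
    · intro t ht; split_ifs <;> exact hT _ (by omega)
  constructor
  · intro hadj
    by_contra hne
    refine hmin (m - (j - i) + 1) (by omega)
      (fun t => if t ≤ i then q t else q (t + (j - i) - 1)) ?_ ?_ ?_ ?_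
    · simpa using h0
    · have a1 : ¬ (m - (j - i) + 1 ≤ i) := by omega
      simp only [a1, if_false]
      rw [show m - (j - i) + 1 + (j - i) - 1 = m by omega]; exact h1
    · intro t ht
      by_cases h1 : t + 1 ≤ i
      · have h2 : t ≤ i := by omega
        simp only [h1, h2, if_true]; exact hq t (by omega)
      · by_cases h2 : t ≤ i
        · obtain rfl : t = i := by omega
          simp only [h1, le_refl, if_true, if_false]
          rw [show t + 1 + (j - t) - 1 = j by omega]
          exact hadj
        · simp only [h1, h2, if_false]
          rw [show t + 1 + (j - i) - 1 = t + (j - i) - 1 + 1 by omega]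
          exact hq _ (by omega)
    · intro t ht; split_ifs <;> exact hT _ (by omega)
  · rintro rfl
    exact hq i (by omega)

/-! ### levels -/

lemma lev_disj {S : Set V} {v : V} {j k : ℕ} (hj : v ∈ levelSet G S j) (hk : v ∈ levelSet G S k) :
    j = k := by
  have h1 : (⨅ s ∈ S, G.edist v s) = (j : ℕ∞) := hj
  have h2 : (⨅ s ∈ S, G.edist v s) = (k : ℕ∞) := hk
  rw [h1] at h2
  exact_mod_cast h2

lemma lev_lip (S : Set V) {u v : V} (h : G.Adj u v) :
    (⨅ s ∈ S, G.edist u s) ≤ (⨅ s ∈ S, G.edist v s) + 1 := by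
  rw [ENat.iInf_add]
  refine le_iInf fun s => ?_
  by_cases hs : s ∈ S
  · simp only [hs, iInf_pos]
    refine (iInf₂_le s hs).trans ?_
    refine (SimpleGraph.edist_triangle (v := v)).trans ?_
    rw [edist_eq_one_iff_adj.2 h, add_comm]
  · simp [hs]

lemma lev_adj {S : Set V} {u v : V} {j k : ℕ} (hj : v ∈ levelSet G S j) (hk : u ∈ levelSet G S k)
    (h : G.Adj v u) : k ≤ j + 1 := by
  have h1 : (⨅ s ∈ S, G.edist v s) = (j : ℕ∞) := hj
  have h2 : (⨅ s ∈ S, G.edist u s) = (k : ℕ∞) := hk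
  have := lev_lip S h.symm
  rw [h1, h2] at this
  exact_mod_cast this

lemma lev_attain {S : Set V} {v : V} {k : ℕ} (h : v ∈ levelSet G S k) :
    ∃ s ∈ S, G.edist v s = (k : ℕ∞) := by
  have h1 : (⨅ s ∈ S, G.edist v s) = (k : ℕ∞) := h
  by_contra hc
  push Not at hc
  have : ((k + 1 : ℕ) : ℕ∞) ≤ ⨅ s ∈ S, G.edist v s := by
    refine le_iInf₂ fun s hs => ?_
    have hle : (k : ℕ∞) ≤ G.edist v s := by rw [← h1]; exact iInf₂_le s hs
    have hlt := lt_of_le_of_ne hle (hc s hs).symm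
    push_cast
    exact Order.add_one_le_of_lt hlt
  rw [h1] at this
  have : k + 1 ≤ k := by exact_mod_cast this
  omega

lemma lev_zero {S : Set V} {v : V} : v ∈ levelSet G S 0 ↔ v ∈ S := by
  constructor
  · intro h
    obtain ⟨s, hs, he⟩ := lev_attain h
    have : v = s := by simpa using he
    exact this ▸ hs
  · intro h
    have : (⨅ s ∈ S, G.edist v s) ≤ 0 := (iInf₂_le v h).trans (by simp)
    change (⨅ s ∈ S, G.edist v s) = ((0 : ℕ) : ℕ∞)
    simpa using this

lemma lev_succ {S : Set V} {v : V} {k : ℕ} (h : v ∈ levelSet G S (k+1)) :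
    ∃ u ∈ levelSet G S k, G.Adj v u := by
  obtain ⟨s, hs, he⟩ := lev_attain h
  obtain ⟨w, hw⟩ := exists_walk_of_edist_eq_coe he
  cases w with
  | nil => simp at hw
  | @cons _ u _ hadj p =>
    refine ⟨u, ?_, hadj⟩
    simp only [Walk.length_cons, Nat.add_right_cancel_iff] at hw
    change (⨅ s ∈ S, G.edist u s) = (k : ℕ∞)
    apply le_antisymm
    · refine (iInf₂_le s hs).trans ?_
      rw [← hw]; exact edist_le p
    · have h1 : (⨅ s ∈ S, G.edist v s) = ((k+1 : ℕ) : ℕ∞) := h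
      have := lev_lip S hadj
      rw [h1] at this
      push_cast at this
      exact (ENat.add_le_add_iff_right (by simp)).1 this

/-- union of the first levels -/
def low (G : SimpleGraph V) (S : Set V) (k : ℕ) : Set V := {v | ∃ j ≤ k, v ∈ levelSet G S j}

lemma low_down {S : Set V} (K : ℕ) : ∀ (k : ℕ), k ≤ K → ∀ v ∈ levelSet G S k,
    ∃ s ∈ S, ∃ w : G.Walk v s, ∀ x ∈ w.support, x ∈ low G S K := by
  intro k
  induction k with
  | zero =>
    intro _ v hv
    refine ⟨v, lev_zero.1 hv, .nil, ?_⟩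
    intro x hx
    have : x = v := by simpa using hx
    subst this
    exact ⟨0, by omega, hv⟩
  | succ k ih =>
    intro hk v hv
    obtain ⟨u, hu, hadj⟩ := lev_succ hv
    obtain ⟨s, hs, w, hw⟩ := ih (by omega) u hu
    refine ⟨s, hs, .cons hadj w, ?_⟩
    intro x hx
    rw [Walk.support_cons, List.mem_cons] at hx
    rcases hx with rfl | hx
    · exact ⟨k+1, hk, hv⟩
    · exact hw x hx

lemma low_conn {S : Set V} (hconn : (G.induce S).Connected) (K : ℕ) {u v : V}
    (hu : u ∈ low G S K) (hv : v ∈ low G S K) :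
    ∃ w : G.Walk u v, ∀ x ∈ w.support, x ∈ low G S K := by
  obtain ⟨j, hj, hu⟩ := hu
  obtain ⟨k, hk, hv⟩ := hv
  obtain ⟨s, hs, w1, h1⟩ := low_down K j hj u hu
  obtain ⟨t, ht, w2, h2⟩ := low_down K k hk v hv
  obtain ⟨w⟩ := hconn.preconnected ⟨s, hs⟩ ⟨t, ht⟩
  let w3 : G.Walk s t := w.map (Embedding.induce S).toHom
  have h3 : ∀ x ∈ w3.support, x ∈ low G S K := by
    intro x hx
    have hx' : x ∈ (w.map (Embedding.induce S).toHom).support := hx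
    rw [Walk.support_map, List.mem_map] at hx'
    obtain ⟨y, _, rfl⟩ := hx'
    exact ⟨0, by omega, lev_zero.2 y.2⟩
  refine ⟨(w1.append w3).append w2.reverse, ?_⟩
  intro x hx
  rw [Walk.mem_support_append_iff, Walk.mem_support_append_iff, Walk.support_reverse,
    List.mem_reverse] at hx
  rcases hx with (hx | hx) | hx
  · exact h1 x hx
  · exact h3 x hx
  · exact h2 x hx

/-- cyclic separation is impossible in a connected set -/
lemma cyclic_sep (D : Set V) (c : ℕ → V) (n : ℕ) (hn : 2 ≤ n)
    (hconn : ∀ u ∈ D, ∀ v ∈ D, ∃ w : G.Walk u v, ∀ x ∈ w.support, x ∈ D)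
    (hD : ∀ s, c s ∈ D) (hne : ∀ s, c s ≠ c (s+1)) (hper : c n = c 0)
    (hsep : ∀ s, ∀ w : G.Walk (c s) (c (s+2)), (∀ x ∈ w.support, x ∈ D) → c (s+1) ∈ w.support) :
    False := by
  classical
  have key : ∀ k, ∀ w : G.Walk (c 0) (c (k+2)), (∀ x ∈ w.support, x ∈ D) → c (k+1) ∈ w.support := by
    intro k
    induction k with
    | zero => exact hsep 0
    | succ k ih =>
      intro w hw
      by_contra hnot
      obtain ⟨p, hp⟩ := hconn _ (hD 0) _ (hD (k+2))
      let p' := p.bypass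
      have hpp : p'.IsPath := p.bypass_isPath
      have hp' : ∀ x ∈ p'.support, x ∈ D := fun x hx => hp x (p.support_bypass_subset_support hx)
      have hmem := ih p' hp'
      have hnot2 : c (k+2) ∉ (p'.takeUntil _ hmem).support :=
        Walk.endpoint_notMem_support_takeUntil hpp hmem (hne (k+1)).symm
      have := hsep (k+1) ((p'.takeUntil _ hmem).reverse.append w) (by
        intro x hx
        rw [Walk.mem_support_append_iff, Walk.support_reverse, List.mem_reverse] at hx
        rcases hx with hx | hx
        · exact hp' x (p'.support_takeUntil_subset_support hmem hx)
        · exact hw x hx)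
      rw [Walk.mem_support_append_iff, Walk.support_reverse, List.mem_reverse] at this
      rcases this with h | h
      · exact hnot2 h
      · exact hnot h
  obtain ⟨m, rfl⟩ : ∃ m, n = m + 2 := ⟨n - 2, by omega⟩
  have := key m ((Walk.nil : G.Walk (c 0) (c 0)).copy rfl hper.symm) (by
    intro x hx
    have : x = c 0 := by simpa using hx
    rw [this]; exact hD 0)
  have h2 : c (m+1) = c 0 := by simpa using this
  exact hne (m+1) (h2.trans hper.symm)

end Aux

namespace Aux

variable {V : Type*} {G : SimpleGraph V}

/-- An odd cycle `p k 0` in level `i` of length `2l+1`, with descending paths `p k t`. -/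
structure Cfg (G : SimpleGraph V) (S : Set V) (l i : ℕ) (p : ℕ → ℕ → V) : Prop where
  hl : 2 ≤ l
  hi : l / 2 + 1 ≤ i
  gir : G.egirth = (2 * l + 1 : ℕ)
  per : ∀ k t, p (k + (2 * l + 1)) t = p k t
  lev : ∀ k t, t ≤ i → p k t ∈ levelSet G S (i - t)
  down : ∀ k t, t < i → G.Adj (p k t) (p k (t+1))
  cyc : ∀ j k, j < k → k < j + (2 * l + 1) →
    p j 0 ≠ p k 0 ∧ (G.Adj (p j 0) (p k 0) ↔ k = j + 1 ∨ k = j + 2 * l)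

/-- path going up, along the cycle and down -/
def seg (p : ℕ → ℕ → V) (a d s s' : ℕ) (t : ℕ) : V :=
  p (a + min (t - s) d) ((s - t) + (t - (s + d)))

section
variable {S : Set V} {l i : ℕ} {p : ℕ → ℕ → V}

lemma Cfg.ne_lev (C : Cfg G S l i p) {k k' t t' : ℕ} (ht : t ≤ i) (ht' : t' ≤ i) (h : t ≠ t') :
    p k t ≠ p k' t' := by
  intro he
  have h1 := C.lev k t ht
  rw [he] at h1
  have := lev_disj h1 (C.lev k' t' ht')
  omega

lemma Cfg.adj_lev (C : Cfg G S l i p) {k k' t t' : ℕ} (ht : t ≤ i) (ht' : t' ≤ i)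
    (h : G.Adj (p k t) (p k' t')) : t ≤ t' + 1 ∧ t' ≤ t + 1 := by
  have h1 := lev_adj (C.lev k t ht) (C.lev k' t' ht') h
  have h2 := lev_adj (C.lev k' t' ht') (C.lev k t ht) h.symm
  omega

lemma Cfg.seg_adj (C : Cfg G S l i p) {a d s s' : ℕ} (hs : s ≤ i) (hs' : s' ≤ i) :
    ∀ t < s + d + s', G.Adj (seg p a d s s' t) (seg p a d s s' (t+1)) := by
  intro t ht
  unfold seg
  by_cases h1 : t + 1 ≤ s
  · have := (C.down a (s - (t + 1)) (by omega)).symm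
    rw [show min (t - s) d = 0 by omega, show min (t + 1 - s) d = 0 by omega,
      show s - t + (t - (s + d)) = s - (t + 1) + 1 by omega,
      show s - (t + 1) + (t + 1 - (s + d)) = s - (t + 1) by omega]
    exact this
  by_cases h2 : t + 1 ≤ s + d
  · rw [show min (t - s) d = t - s by omega, show min (t + 1 - s) d = t - s + 1 by omega,
      show s - t + (t - (s + d)) = 0 by omega,
      show s - (t + 1) + (t + 1 - (s + d)) = 0 by omega]
    have := C.hl
    exact (C.cyc _ _ (by omega) (by omega)).2.2 (Or.inl (by omega))
  · rw [show min (t - s) d = d by omega, show min (t + 1 - s) d = d by omega,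
      show s - t + (t - (s + d)) = t - (s + d) by omega,
      show s - (t + 1) + (t + 1 - (s + d)) = t - (s + d) + 1 by omega]
    exact C.down _ _ (by omega)

lemma Cfg.seg_nb (C : Cfg G S l i p) {a d s s' : ℕ} (hs : s ≤ i) (hs' : s' ≤ i) (hd : 1 ≤ d) :
    ∀ t, t + 2 ≤ s + d + s' → seg p a d s s' t ≠ seg p a d s s' (t+2) := by
  intro t ht
  unfold seg
  by_cases h : s - t + (t - (s + d)) = s - (t + 2) + (t + 2 - (s + d))
  · rw [show s - t + (t - (s + d)) = 0 by omega, show s - (t + 2) + (t + 2 - (s + d)) = 0 by omega]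
    have := C.hl
    exact (C.cyc _ _ (by omega) (by omega)).1
  · exact C.ne_lev (by omega) (by omega) h

lemma seg_zero (a d s s' : ℕ) : seg p a d s s' 0 = p a s := by
  unfold seg
  rw [show min (0 - s) d = 0 by omega, show s - 0 + (0 - (s + d)) = s by omega, Nat.add_zero]

lemma seg_end (a d s s' : ℕ) : seg p a d s s' (s + d + s') = p (a + d) s' := by
  unfold seg
  rw [show min (s + d + s' - s) d = d by omega,
    show s - (s + d + s') + (s + d + s' - (s + d)) = s' by omega]

lemma Cfg.ne_small (C : Cfg G S l i p) {a d s s' : ℕ} (hs : s ≤ l / 2) (hs' : s' ≤ l / 2)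
    (hd : 1 ≤ d) (hdl : d ≤ l) : p a s ≠ p (a + d) s' := by
  have hi := C.hi
  by_cases h : s = s'
  · subst h
    intro he
    have := girth_nb C.gir (s + d + s) (by omega) (seg p a d s s)
      (C.seg_adj (by omega) (by omega)) (C.seg_nb (by omega) (by omega) hd)
      (by rw [seg_zero, seg_end]; exact he)
    omega
  · exact C.ne_lev (by omega) (by omega) h

lemma Cfg.ne (C : Cfg G S l i p) {a d s s' : ℕ} (hs : s ≤ l / 2) (hs' : s' ≤ l / 2)
    (hd : 1 ≤ d) (hdl : d ≤ 2 * l) : p a s ≠ p (a + d) s' := by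
  by_cases h : d ≤ l
  · exact C.ne_small hs hs' hd h
  · have := C.ne_small (a := a + d) (d := 2 * l + 1 - d) hs' hs (by omega) (by omega)
    rw [show a + d + (2 * l + 1 - d) = a + (2 * l + 1) by omega, C.per] at this
    exact this.symm

lemma Cfg.nadj_small (C : Cfg G S l i p) {a d s s' : ℕ} (hs : s ≤ l / 2) (hs' : s' ≤ l / 2)
    (hd : 1 ≤ d) (hdl : d ≤ l) (h : G.Adj (p a s) (p (a + d) s')) :
    (s = 0 ∧ s' = 0) ∨ (s = l / 2 ∧ s' = l / 2 ∧ 2 * (l / 2) = l) := by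
  have hi := C.hi
  have hl := C.hl
  by_contra hc
  have hlev := C.adj_lev (by omega) (by omega) h
  have := girth_nb_edge C.gir (s + d + s') (by omega) (seg p a d s s')
    (C.seg_adj (by omega) (by omega)) (C.seg_nb (by omega) (by omega) hd)
    (by rw [seg_zero, seg_end]; exact h.symm)
    (by
      rw [seg_zero]
      unfold seg
      by_cases hk : min (s + d + s' - 1 - s) d = 0
      · exact C.ne_lev (by omega) (by omega) (by omega)
      · exact (C.ne (by omega) (by omega) (by omega) (by omega)).symm)
  omega

lemma Cfg.nadj (C : Cfg G S l i p) {a d s s' : ℕ} (hs : s ≤ l / 2) (hs' : s' ≤ l / 2)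
    (hd : 1 ≤ d) (hdl : d ≤ 2 * l) (h : G.Adj (p a s) (p (a + d) s')) :
    (s = 0 ∧ s' = 0) ∨ (s = l / 2 ∧ s' = l / 2 ∧ 2 * (l / 2) = l) := by
  by_cases hc : d ≤ l
  · exact C.nadj_small hs hs' hd hc h
  · have := C.nadj_small (a := a + d) (d := 2 * l + 1 - d) hs' hs (by omega) (by omega)
      (by rw [show a + d + (2 * l + 1 - d) = a + (2 * l + 1) by omega, C.per]; exact h.symm)
    omega

lemma Cfg.seg_ind (C : Cfg G S l i p) {a d : ℕ} (hd : 2 ≤ d) (hdl : d ≤ 2 * l - 1)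
    (hna : ¬ G.Adj (p a (l / 2)) (p (a + d) (l / 2))) :
    IndP G (l / 2 + d + l / 2) (seg p a d (l / 2) (l / 2)) := by
  have hi := C.hi
  have hl := C.hl
  intro x y hxy hy
  have hadj := C.seg_adj (a := a) (d := d) (s := l / 2) (s' := l / 2) (by omega) (by omega)
  suffices h : seg p a d (l / 2) (l / 2) x ≠ seg p a d (l / 2) (l / 2) y ∧
      (G.Adj (seg p a d (l / 2) (l / 2) x) (seg p a d (l / 2) (l / 2) y) → y = x + 1) by
    refine ⟨h.1, h.2, ?_⟩
    rintro rfl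
    exact hadj x (by omega)
  unfold seg
  have hσx : l / 2 - x + (x - (l / 2 + d)) ≤ l / 2 := by omega
  have hσy : l / 2 - y + (y - (l / 2 + d)) ≤ l / 2 := by omega
  by_cases hk : min (x - l / 2) d = min (y - l / 2) d
  · rw [← hk]
    refine ⟨C.ne_lev (by omega) (by omega) (by omega), ?_⟩
    intro h
    have := C.adj_lev (by omega) (by omega) h
    omega
  · have e : a + min (y - l / 2) d =
        a + min (x - l / 2) d + (min (y - l / 2) d - min (x - l / 2) d) := by omega
    have h1 : 1 ≤ min (y - l / 2) d - min (x - l / 2) d := by omega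
    have h2 : min (y - l / 2) d - min (x - l / 2) d ≤ 2 * l := by omega
    rw [e]
    refine ⟨C.ne hσx hσy h1 h2, ?_⟩
    intro h
    rcases C.nadj hσx hσy h1 h2 h with ⟨h3, h4⟩ | ⟨h3, h4, -⟩
    · rw [h3, h4] at h
      have := (C.cyc _ _ (by omega) (by omega)).2.1 h
      omega
    · exfalso
      apply hna
      rw [h3, h4, ← e] at h
      rw [show min (x - l / 2) d = 0 by omega, show min (y - l / 2) d = d by omega] at h
      exact h

lemma Cfg.low_sep (C : Cfg G S l i p) {k t : ℕ} (ht : t ≤ l / 2) {x : V}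
    (hx : x ∈ low G S (i - l / 2 - 1)) :
    p k t ≠ x ∧ (t < l / 2 → ¬ G.Adj (p k t) x) := by
  have hi := C.hi
  obtain ⟨j, hj, hxj⟩ := hx
  have h1 := C.lev k t (by omega)
  constructor
  · rintro rfl
    have := lev_disj h1 hxj
    omega
  · intro hlt h
    have := lev_adj hxj h1 h.symm
    omega

lemma Cfg.hole (C : Cfg G S l i p) (hG : G.MemGFamily l) {a d m : ℕ} (hd : 2 ≤ d)
    (hdl : d ≤ 2 * l - 1) (hna : ¬ G.Adj (p a (l / 2)) (p (a + d) (l / 2))) {q : ℕ → V}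
    (hq : IndP G m q) (h0 : q 0 = p a (l / 2)) (hm : q m = p (a + d) (l / 2))
    (hlow : ∀ t, 0 < t → t < m → q t ∈ low G S (i - l / 2 - 1)) (hm2 : 2 ≤ m)
    (hodd : Odd (m + d)) : m + 2 * (l / 2) + d = 2 * l + 1 := by
  have hc := glue (C.seg_ind hd hdl hna) hq (by omega) hm2 (by rw [seg_zero, h0])
    (by rw [seg_end, hm]) (by
      intro s t hs0 hs ht0 ht
      have := C.low_sep (k := a + min (s - l / 2) d) (t := l / 2 - s + (s - (l / 2 + d)))
        (by omega) (hlow t ht0 ht)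
      exact ⟨this.1, this.2 (by have := C.hl; omega)⟩)
  have := hc.length_eq C.hl hG (by omega) (by
    have e : l / 2 + d + l / 2 + m = 2 * (l / 2) + (m + d) := by omega
    rw [e]; exact (even_two_mul _).add_odd hodd)
  omega

/-- all lower connections between antipodal ancestors have length two, and `l` is odd -/
lemma Cfg.link (C : Cfg G S l i p) (hG : G.MemGFamily l) {a m : ℕ}
    (hna : ¬ G.Adj (p a (l / 2)) (p (a + l) (l / 2))) {q : ℕ → V}
    (hq : IndP G m q) (h0 : q 0 = p a (l / 2)) (hm : q m = p (a + l) (l / 2))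
    (hlow : ∀ t, 0 < t → t < m → q t ∈ low G S (i - l / 2 - 1)) :
    m = 2 ∧ 2 * (l / 2) + 1 = l := by
  have hl := C.hl
  have hm2 : 2 ≤ m := by
    by_contra hlt
    have : m = 0 ∨ m = 1 := by omega
    rcases this with rfl | rfl
    · rw [h0] at hm
      exact C.ne le_rfl le_rfl (by omega) (by omega) hm
    · apply hna
      rw [← h0, ← hm]
      exact (hq 0 1 (by omega) (by omega)).2.2 rfl
  rcases Nat.even_or_odd (m + l) with he | ho
  · have hq' : IndP G m (fun t => q (m - t)) := by
      intro x y hxy hy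
      have := hq (m - y) (m - x) (by omega) (by omega)
      rw [ne_comm, G.adj_comm]
      refine ⟨this.1, this.2.trans ?_⟩
      omega
    have e : p (a + l + (l + 1)) (l / 2) = p a (l / 2) := by
      rw [show a + l + (l + 1) = a + (2 * l + 1) by omega, C.per]
    have := C.hole hG (a := a + l) (d := l + 1) (by omega) (by omega)
      (by rw [e]; exact fun h => hna h.symm) hq' (by simpa using hm) (by simpa [e] using h0)
      (by intro t ht0 ht; exact hlow _ (by omega) (by omega)) hm2
      (by rw [← Nat.add_assoc]; exact he.add_one)
    omega
  · have := C.hole hG hl (by omega) hna hq h0 hm hlow hm2 ho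
    omega

/-- a walk through the low part gives a common neighbour -/
lemma Cfg.common (C : Cfg G S l i p) (hG : G.MemGFamily l) {a : ℕ}
    (hna : ¬ G.Adj (p a (l / 2)) (p (a + l) (l / 2))) {D : Set V}
    (hD : D ⊆ low G S (i - l / 2 - 1)) {x y : V} (w : G.Walk x y) (hw : ∀ z ∈ w.support, z ∈ D)
    (hx : G.Adj (p a (l / 2)) x) (hy : G.Adj y (p (a + l) (l / 2))) :
    2 * (l / 2) + 1 = l ∧
      ∃ c ∈ D, G.Adj (p a (l / 2)) c ∧ G.Adj c (p (a + l) (l / 2)) := by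
  obtain ⟨m, q, h0, hm, hq, hT⟩ := shortest
    (T := D ∪ {p a (l / 2), p (a + l) (l / 2)}) ((Walk.cons hx w).append (Walk.cons hy .nil)) (by
      intro z hz
      rw [Walk.mem_support_append_iff, Walk.support_cons, List.mem_cons] at hz
      rcases hz with (rfl | hz) | hz
      · exact Or.inr (Or.inl rfl)
      · exact Or.inl (hw z hz)
      · rw [Walk.support_cons, List.mem_cons, Walk.support_nil, List.mem_singleton] at hz
        rcases hz with rfl | rfl
        · exact Or.inl (hw _ w.end_mem_support)
        · exact Or.inr (Or.inr rfl))
  have hmid : ∀ t, 0 < t → t < m → q t ∈ D := by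
    intro t ht0 ht
    rcases hT t (by omega) with h | h | h
    · exact h
    · exact absurd (h0.trans h.symm) (hq 0 t ht0 (by omega)).1
    · exact absurd ((h : q t = _).trans hm.symm) (hq t m ht (by omega)).1
  obtain ⟨hm2, hodd⟩ := C.link hG hna hq h0 hm (fun t a b => hD (hmid t a b))
  subst hm2
  refine ⟨hodd, q 1, hmid 1 (by omega) (by omega), ?_, ?_⟩
  · rw [← h0]; exact (hq 0 1 (by omega) (by omega)).2.2 rfl
  · rw [← hm]; exact (hq 1 2 (by omega) (by omega)).2.2 rfl

lemma Cfg.common' (C : Cfg G S l i p) (hG : G.MemGFamily l) (hconn : (G.induce S).Connected)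
    (a : ℕ) (hna : ¬ G.Adj (p a (l / 2)) (p (a + l) (l / 2))) :
    2 * (l / 2) + 1 = l ∧
      ∃ c ∈ low G S (i - l / 2 - 1), G.Adj (p a (l / 2)) c ∧ G.Adj c (p (a + l) (l / 2)) := by
  have hi := C.hi
  have hl : ∀ k, p k (l / 2 + 1) ∈ low G S (i - l / 2 - 1) := fun k =>
    ⟨_, le_of_eq (by omega), C.lev k (l / 2 + 1) (by omega)⟩
  obtain ⟨w, hw⟩ := low_conn hconn _ (hl a) (hl (a + l))
  exact C.common hG hna subset_rfl w hw (C.down _ _ (by omega)) (C.down _ _ (by omega)).symm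

lemma Cfg.per_mul (C : Cfg G S l i p) (k t j : ℕ) : p (k + (2 * l + 1) * j) t = p k t := by
  induction j with
  | zero => simp
  | succ j ih => rw [Nat.mul_succ, ← Nat.add_assoc, C.per, ih]

lemma Cfg.odd_false (C : Cfg G S l i p) (hG : G.MemGFamily l) (hconn : (G.induce S).Connected)
    (hodd : 2 * (l / 2) + 1 = l) : False := by
  have hi := C.hi
  have hl := C.hl
  have hna : ∀ a, ¬ G.Adj (p a (l / 2)) (p (a + l) (l / 2)) := by
    intro a h
    have := C.nadj le_rfl le_rfl (by omega) (by omega) h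
    omega
  choose c hcD hc1 hc2 using fun a => (C.common' hG hconn a (hna a)).2
  have huniq : ∀ a x, G.Adj (p a (l / 2)) x → G.Adj x (p (a + l) (l / 2)) → x = c a := by
    intro a x h1 h2
    exact four_cycle C.gir (by omega) h1 h2 (hc2 a).symm (hc1 a).symm
      (C.ne le_rfl le_rfl (by omega) (by omega))
  have e1 : ∀ s, s * l + l = (s + 1) * l := fun s => by ring
  refine cyclic_sep (G := G) (low G S (i - l / 2 - 1)) (fun s => c (s * l)) (2 * l + 1) (by omega)
    (fun u hu v hv => low_conn hconn _ hu hv) (fun s => hcD _) ?_ ?_ ?_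
  · intro s he
    set a := s * l with ha
    rw [← e1, ← ha] at he
    have e : p (a + 2 * l + 1) (l / 2) = p a (l / 2) := C.per a _
    have hadj : G.Adj (c a) (p (a + 2 * l) (l / 2)) := by
      have := hc2 (a + l)
      rw [← he, show a + l + l = a + 2 * l by omega] at this
      exact this
    have := girth_nb_two C.gir (l / 2 + 1 + l / 2) (by omega)
      (seg p (a + 2 * l) 1 (l / 2) (l / 2)) (C.seg_adj (by omega) (by omega))
      (C.seg_nb (by omega) (by omega) le_rfl) (c a)
      (by rw [seg_end, e]; exact hc1 a)
      (by rw [seg_zero]; exact hadj)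
      (by unfold seg; exact (C.low_sep (by omega) (hcD a)).1)
      (by rw [seg_end, seg_zero]; exact (C.ne le_rfl le_rfl le_rfl (by omega)).symm)
    omega
  · symm
    have e : ∀ k t, p (k + (2 * l + 1) * l) t = p k t := fun k t => C.per_mul k t l
    rw [Nat.zero_mul]
    refine huniq _ _ ?_ ?_
    · have := hc1 0
      rw [← e, Nat.zero_add] at this
      exact this
    · have := hc2 0
      rw [← e, show 0 + l + (2 * l + 1) * l = (2 * l + 1) * l + l by ring] at this
      exact this
  · intro s w hw
    by_contra hnot
    obtain ⟨-, x, hx, hx1, hx2⟩ := C.common hG (hna ((s + 1) * l))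
      (D := {z | z ∈ low G S (i - l / 2 - 1) ∧ z ≠ c ((s + 1) * l)}) (fun z hz => hz.1) w
      (fun z hz => ⟨hw z hz, fun h => hnot (h ▸ hz)⟩)
      (by have := hc2 (s * l); rw [e1] at this; exact this.symm)
      (by have := hc1 ((s + 2) * l); rw [← e1 (s + 1)] at this ⊢; exact this.symm)
    exact hx.2 (huniq _ _ hx1 hx2)

lemma Cfg.even_false (C : Cfg G S l i p)
    (hadj : ∀ a, G.Adj (p a (l / 2)) (p (a + l) (l / 2)))
    (hcol : (G.induce (levelSet G S (i - l / 2))).Colorable 2) : False := by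
  have hi := C.hi
  obtain ⟨f⟩ := hcol
  let g : ℕ → Fin 2 := fun a => f ⟨p a (l / 2), C.lev a (l / 2) (by omega)⟩
  have hg : ∀ a, g a ≠ g (a + l) := fun a => f.valid (hadj a)
  have hper : ∀ a, g (a + 2 * l + 1) = g a := by
    intro a
    have e : p (a + 2 * l + 1) (l / 2) = p a (l / 2) := C.per a _
    simp only [g, e]
  have h2 : ∀ a, g (a + 2 * l) = g a := by
    intro a
    have h1 := hg a
    have h3 := hg (a + l)
    rw [show a + l + l = a + 2 * l by omega] at h3
    omega
  have h3 : ∀ a, g (a + 1) = g a := by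
    intro a
    rw [← h2 (a + 1), show a + 1 + 2 * l = a + 2 * l + 1 by omega, hper]
  have h4 : ∀ b, g b = g 0 := by
    intro b
    induction b with
    | zero => rfl
    | succ b ih => rw [h3, ih]
  exact hg 0 ((h4 0).trans (h4 (0 + l)).symm)

end

end Aux

/-- let `G ∈ 𝒢_ℓ` (`ℓ ≥ 2`) and `S ≠ ∅` with `G[S]` connected.  If
`G[L_i(S)]` is bipartite for each `1 ≤ i ≤ ⌊ℓ/2⌋`, then `G[L_i(S)]` is bipartite for
every `i > 0`. -/
theorem stmt_1 {V : Type*} [Fintype V] (l : ℕ) (hl : 2 ≤ l) (G : SimpleGraph V)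
    (hG : G.MemGFamily l) (S : Set V) (hS : S.Nonempty)
    (hconn : (G.induce S).Connected)
    (hbip : ∀ i : ℕ, 1 ≤ i → i ≤ l / 2 → (G.induce (levelSet G S i)).Colorable 2) :
    ∀ i : ℕ, 0 < i → (G.induce (levelSet G S i)).Colorable 2 := by
  intro i
  induction i using Nat.strong_induction_on with
  | _ i ih =>
    intro hi0
    by_cases hi : i ≤ l / 2
    · exact hbip i hi0 hi
    by_contra hnot
    obtain ⟨n, f, hodd, hn3, hf, hfT⟩ := Aux.odd_ind_cycle _ hnot
    obtain rfl := hf.length_eq hl hG hn3 hodd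
    have hpar : ∀ x : V, ∃ y : V, ∀ k, x ∈ levelSet G S (k+1) → y ∈ levelSet G S k ∧ G.Adj x y := by
      intro x
      by_cases h : ∃ k, x ∈ levelSet G S (k+1)
      · obtain ⟨k, hk⟩ := h
        obtain ⟨y, hy, hadj⟩ := Aux.lev_succ hk
        refine ⟨y, fun k' hk' => ?_⟩
        have := Aux.lev_disj hk hk'
        obtain rfl : k = k' := by omega
        exact ⟨hy, hadj⟩
      · exact ⟨x, fun k hk => absurd ⟨k, hk⟩ h⟩
    choose par hpar using hpar
    let p : ℕ → ℕ → V := fun k t => par^[t] (f (k % (2 * l + 1)))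
    have hlev : ∀ k t, t ≤ i → p k t ∈ levelSet G S (i - t) := by
      intro k t
      induction t with
      | zero => intro _; exact hfT _
      | succ t iht =>
        intro ht
        have h1 := iht (by omega)
        rw [show i - t = i - (t + 1) + 1 by omega] at h1
        have := (hpar _ _ h1).1
        simp only [p, Function.iterate_succ_apply'] at this ⊢
        exact this
    have C : Aux.Cfg G S l i p :=
      { hl := hl
        hi := by omega
        gir := hG.1
        per := by intro k t; simp [p]
        lev := hlev
        down := by
          intro k t ht
          have h1 := hlev k t (by omega)
          rw [show i - t = i - (t + 1) + 1 by omega] at h1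
          have := (hpar _ _ h1).2
          simp only [p, Function.iterate_succ_apply'] at this ⊢
          exact this
        cyc := by
          intro j k hjk hk
          exact Aux.periodic_cycle hn3 hf j k hjk hk }
    by_cases hex : ∃ a, ¬ G.Adj (p a (l / 2)) (p (a + l) (l / 2))
    · obtain ⟨a, ha⟩ := hex
      exact C.odd_false hG hconn (C.common' hG hconn a ha).1
    · push Not at hex
      exact C.even_false hex (ih (i - l / 2) (by omega) (by omega))
end

section
/- For every integer ℓ ≥ 2 and every graph G in 𝒢_ℓ, the chromatic number of G satisfies χ(G) ≤ 4. -/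
open SimpleGraph

/-- `f 0, …, f q` is an induced path. -/
def IP {V : Type*} (G : SimpleGraph V) (q : ℕ) (f : ℕ → V) : Prop :=
  ∀ i j, i < j → j ≤ q → f i ≠ f j ∧ (G.Adj (f i) (f j) ↔ j = i + 1)

/-- `f 0, …, f (N-1)` is an induced cycle. -/
def IC {V : Type*} (G : SimpleGraph V) (N : ℕ) (f : ℕ → V) : Prop :=
  ∀ i j, i < j → j < N → f i ≠ f j ∧ (G.Adj (f i) (f j) ↔ (j = i + 1 ∨ (i = 0 ∧ j + 1 = N)))

/-- periodic odd closed sequence inside level `n` -/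
def OC {V : Type*} (G : SimpleGraph V) (lev : V → ℕ) (n N : ℕ) (c : ℕ → V) : Prop :=
  (∀ j, c (j + N) = c j) ∧ (∀ j, G.Adj (c j) (c (j + 1))) ∧ ∀ j, lev (c j) = n

/-- induced path of length `q` from `x` to `y` with interior in levels below `n` -/
def UP {V : Type*} (G : SimpleGraph V) (lev : V → ℕ) (n : ℕ) (x y : V) (q : ℕ) : Prop :=
  ∃ f : ℕ → V, IP G q f ∧ f 0 = x ∧ f q = y ∧ ∀ i, 0 < i → i < q → lev (f i) < n

theorem walk_of_seq {V : Type*} (G : SimpleGraph V) (f : ℕ → V) (n : ℕ)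
    (h : ∀ i, i < n → G.Adj (f i) (f (i + 1))) :
    ∃ w : G.Walk (f n) (f 0), w.length = n ∧ (∀ v, v ∈ w.support ↔ ∃ i ≤ n, v = f i) ∧
      (∀ e, e ∈ w.edges ↔ ∃ i < n, e = s(f i, f (i + 1))) ∧
      ((∀ i j, i < j → j ≤ n → f i ≠ f j) → w.IsPath) := by
  induction n with
  | zero => exact ⟨Walk.nil, by simp⟩
  | succ n ih =>
    obtain ⟨w, h1, h2, h3, h4⟩ := ih (fun i hi => h i (by omega))
    refine ⟨Walk.cons (h n (by omega)).symm w, by simp [h1], ?_, ?_, ?_⟩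
    · intro v
      simp only [Walk.support_cons, List.mem_cons, h2]
      constructor
      · rintro (rfl | ⟨i, hi, rfl⟩)
        · exact ⟨n + 1, le_rfl, rfl⟩
        · exact ⟨i, by omega, rfl⟩
      · rintro ⟨i, hi, rfl⟩
        rcases Nat.lt_or_ge n i with h | h
        · left; congr 1; omega
        · right; exact ⟨i, h, rfl⟩
    · intro e
      simp only [Walk.edges_cons, List.mem_cons, h3]
      constructor
      · rintro (rfl | ⟨i, hi, rfl⟩)
        · exact ⟨n, by omega, Sym2.eq_swap⟩
        · exact ⟨i, by omega, rfl⟩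
      · rintro ⟨i, hi, rfl⟩
        rcases Nat.lt_or_ge i n with h | h
        · right; exact ⟨i, h, rfl⟩
        · left
          obtain rfl : i = n := by omega
          exact Sym2.eq_swap
    · intro hinj
      rw [Walk.cons_isPath_iff]
      refine ⟨h4 (fun i j hij hj => hinj i j hij (by omega)), ?_⟩
      rw [h2]
      rintro ⟨i, hi, he⟩
      exact hinj i (n + 1) (by omega) le_rfl he.symm

theorem IC.cycle {V : Type*} {G : SimpleGraph V} {N : ℕ} {f : ℕ → V} (hN : 3 ≤ N)
    (h : IC G N f) : ∃ (v : V) (w : G.Walk v v), w.IsCycle ∧ w.toSubgraph.IsInduced ∧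
      w.length = N := by
  obtain ⟨n, rfl⟩ : ∃ n, N = n + 1 := ⟨N - 1, by omega⟩
  obtain ⟨w, h1, h2, h3, h4⟩ := walk_of_seq G f n
    (fun i hi => (h i (i + 1) (by omega) (by omega)).2.2 (Or.inl rfl))
  have ha : G.Adj (f 0) (f n) := (h 0 n (by omega) (by omega)).2.2 (Or.inr ⟨rfl, rfl⟩)
  refine ⟨f 0, Walk.cons ha w, ?_, ?_, by simp [h1]⟩
  · rw [Walk.cons_isCycle_iff]
    refine ⟨h4 (fun i j hij hj => (h i j hij (by omega)).1), ?_⟩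
    rw [h3]
    rintro ⟨i, hi, he⟩
    rw [Sym2.eq_iff] at he
    rcases he with ⟨e1, e2⟩ | ⟨e1, e2⟩
    · rcases Nat.eq_zero_or_pos i with rfl | hi0
      · exact (h 1 n (by omega) (by omega)).1 e2.symm
      · exact (h 0 i hi0 (by omega)).1 e1
    · exact (h 0 (i + 1) (by omega) (by omega)).1 e1
  · have key : ∀ i j, i < j → j ≤ n → G.Adj (f i) (f j) →
        s(f i, f j) ∈ (Walk.cons ha w).edges := by
      intro i j hij hj hadj
      rw [Walk.edges_cons, List.mem_cons, h3]
      rcases (h i j hij (by omega)).2.1 hadj with rfl | ⟨rfl, h5⟩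
      · exact Or.inr ⟨i, by omega, rfl⟩
      · obtain rfl : j = n := by omega
        exact Or.inl rfl
    have hsup : ∀ v, v ∈ (Walk.cons ha w).support → ∃ i ≤ n, v = f i := by
      intro v hv
      rw [Walk.support_cons, List.mem_cons, h2] at hv
      rcases hv with rfl | hv
      · exact ⟨0, by omega, rfl⟩
      · exact hv
    intro x hx y hy hadj
    rw [Walk.mem_verts_toSubgraph] at hx hy
    obtain ⟨i, hi, rfl⟩ := hsup _ hx
    obtain ⟨j, hj, rfl⟩ := hsup _ hy
    rw [Walk.adj_toSubgraph_iff_mem_edges]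
    rcases lt_trichotomy i j with hij | rfl | hij
    · exact key i j hij hj hadj
    · exact absurd hadj (G.loopless.irrefl _)
    · rw [Sym2.eq_swap]
      exact key j i hij hi hadj.symm

theorem IC.ge {V : Type*} {G : SimpleGraph V} {l N : ℕ} {f : ℕ → V} (hG : G.MemGFamily l)
    (hN : 3 ≤ N) (h : IC G N f) : 2 * l + 1 ≤ N := by
  obtain ⟨v, w, hc, -, rfl⟩ := h.cycle hN
  have := hc.egirth_le_length
  rw [hG.1] at this
  exact_mod_cast this

theorem IC.eq {V : Type*} {G : SimpleGraph V} {l N : ℕ} {f : ℕ → V} (hl : 2 ≤ l)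
    (hG : G.MemGFamily l)
    (hN : 3 ≤ N) (h : IC G N f) (ho : Odd N) : N = 2 * l + 1 := by
  have h1 := h.ge hG hN
  by_contra hne
  obtain ⟨k, rfl⟩ := ho
  exact hG.2 _ ⟨k, rfl⟩ (by omega) ⟨by omega, h.cycle hN⟩

theorem glue {V : Type*} {G : SimpleGraph V} {q s : ℕ} {f g : ℕ → V} (hf : IP G q f)
    (hg : IP G s g) (h : ∀ i ≤ q, ∀ j ≤ s, f i ≠ g j ∧
      (G.Adj (f i) (g j) ↔ (i = q ∧ j = 0) ∨ (i = 0 ∧ j = s))) :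
    IC G (q + s + 2) (fun i => if i ≤ q then f i else g (i - q - 1)) := by
  intro i j hij hj
  by_cases hi' : i ≤ q <;> by_cases hj' : j ≤ q
  · simp only [hi', hj', if_true]
    refine ⟨(hf i j hij hj').1, (hf i j hij hj').2.trans ?_⟩
    omega
  · simp only [hi', hj', if_true, if_false]
    refine ⟨(h i hi' (j - q - 1) (by omega)).1, (h i hi' (j - q - 1) (by omega)).2.trans ?_⟩
    omega
  · omega
  · simp only [hi', hj', if_false]
    have := hg (i - q - 1) (j - q - 1) (by omega) (by omega)
    refine ⟨this.1, this.2.trans ?_⟩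
    omega

theorem IP.rev {V : Type*} {G : SimpleGraph V} {q : ℕ} {f : ℕ → V} (hf : IP G q f) :
    IP G q (fun i => f (q - i)) := by
  intro i j hij hj
  have := hf (q - j) (q - i) (by omega) (by omega)
  refine ⟨this.1.symm, (G.adj_comm _ _).trans (this.2.trans ?_)⟩
  omega

theorem UP.symm {V : Type*} {G : SimpleGraph V} {lev : V → ℕ} {n : ℕ} {x y : V} {q : ℕ}
    (h : UP G lev n x y q) : UP G lev n y x q := by
  obtain ⟨f, h1, h2, h3, h4⟩ := h
  exact ⟨_, h1.rev, by simpa using h3, by simpa using h2, fun i h5 h6 => h4 _ (by omega) (by omega)⟩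

theorem UP.zero {V : Type*} {G : SimpleGraph V} {lev : V → ℕ} {n : ℕ} (x : V) :
    UP G lev n x x 0 :=
  ⟨fun _ => x, fun i j h1 h2 => by omega, rfl, rfl, fun i h1 h2 => by omega⟩

theorem UP.one {V : Type*} {G : SimpleGraph V} {lev : V → ℕ} {n : ℕ} {x y : V}
    (h : G.Adj x y) : UP G lev n x y 1 := by
  refine ⟨fun i => if i = 0 then x else y, fun i j h1 h2 => ?_, rfl, rfl, fun i h1 h2 => by omega⟩
  obtain rfl : i = 0 := by omega
  obtain rfl : j = 1 := by omega
  simpa [h] using h.ne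

theorem UP.two {V : Type*} {G : SimpleGraph V} {lev : V → ℕ} {n : ℕ} {x y e : V}
    (hne : x ≠ y) (hna : ¬ G.Adj x y) (hx : G.Adj x e) (hy : G.Adj y e) (he : lev e < n) :
    UP G lev n x y 2 := by
  refine ⟨fun i => if i = 0 then x else if i = 1 then e else y, fun i j h1 h2 => ?_, rfl, rfl,
    fun i h1 h2 => ?_⟩
  · obtain ⟨rfl, rfl⟩ | ⟨rfl, rfl⟩ | ⟨rfl, rfl⟩ :
      (i = 0 ∧ j = 1) ∨ (i = 0 ∧ j = 2) ∨ (i = 1 ∧ j = 2) := by omega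
    · simpa [hx] using hx.ne
    · simpa [hna] using hne
    · simpa [hy.symm] using hy.ne.symm
  · obtain rfl : i = 1 := by omega
    simpa using he

theorem UP.extend {V : Type*} {G : SimpleGraph V} {lev : V → ℕ} {n q : ℕ} {x y e e' : V}
    (h1 : ∀ v w, G.Adj v w → lev v ≤ lev w + 1)
    (lx : lev x = n + 1) (ly : lev y = n + 1) (le : lev e = n) (le' : lev e' = n)
    (hx : G.Adj x e) (hy : G.Adj y e') (hne : x ≠ y) (hna : ¬ G.Adj x y)
    (hey : ¬ G.Adj e y) (hex : ¬ G.Adj e' x) (h : UP G lev n e e' q) :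
    UP G lev (n + 1) x y (q + 2) := by
  obtain ⟨f, hf, f0, fq, hlev⟩ := h
  have hq : q ≠ 0 := by
    rintro rfl
    rw [f0] at fq
    exact hey (fq ▸ hy.symm)
  have hl : ∀ i ≤ q, lev (f i) ≤ n := by
    intro i hi
    rcases Nat.eq_zero_or_pos i with rfl | hi0
    · rw [f0, le]
    · rcases Nat.lt_or_ge i q with h | h
      · exact (hlev i hi0 h).le
      · obtain rfl : i = q := by omega
        rw [fq, le']
  have hxa : ∀ i ≤ q, x ≠ f i ∧ (G.Adj x (f i) ↔ i = 0) := by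
    intro i hi
    refine ⟨fun hh => by have := hl i hi; rw [← hh] at this; omega, ?_⟩
    constructor
    · intro ha
      by_contra hi0
      rcases Nat.lt_or_ge i q with h | h
      · have := hlev i (by omega) h
        have := h1 _ _ ha
        omega
      · obtain rfl : i = q := by omega
        rw [fq] at ha
        exact hex ha.symm
    · rintro rfl
      rwa [f0]
  have hya : ∀ i ≤ q, f i ≠ y ∧ (G.Adj (f i) y ↔ i = q) := by
    intro i hi
    refine ⟨fun hh => by have := hl i hi; rw [hh] at this; omega, ?_⟩
    constructor
    · intro ha
      by_contra hi0
      rcases Nat.eq_zero_or_pos i with rfl | h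
      · rw [f0] at ha
        exact hey ha
      · have := hlev i (by omega) (by omega)
        have := h1 _ _ ha.symm
        omega
    · rintro rfl
      rw [fq]
      exact hy.symm
  refine ⟨fun i => if i = 0 then x else if i ≤ q + 1 then f (i - 1) else y, ?_, by simp, by simp,
    ?_⟩
  · intro i j hij hj
    rcases Nat.eq_zero_or_pos i with rfl | hi0
    · rcases Nat.lt_or_ge (q + 1) j with hjq | hjq
      · simp only [if_true, if_neg (show ¬ j = 0 by omega), if_neg (show ¬ j ≤ q + 1 by omega)]
        exact ⟨hne, iff_of_false hna (by omega)⟩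
      · simp only [if_true, if_neg (show ¬ j = 0 by omega), if_pos hjq]
        have := hxa (j - 1) (by omega)
        exact ⟨this.1, this.2.trans (by omega)⟩
    · rcases Nat.lt_or_ge (q + 1) j with hjq | hjq
      · simp only [if_neg (show ¬ i = 0 by omega), if_neg (show ¬ j = 0 by omega),
          if_neg (show ¬ j ≤ q + 1 by omega), if_pos (show i ≤ q + 1 by omega)]
        have := hya (i - 1) (by omega)
        exact ⟨this.1, this.2.trans (by omega)⟩
      · simp only [if_neg (show ¬ i = 0 by omega), if_neg (show ¬ j = 0 by omega),
          if_pos hjq, if_pos (show i ≤ q + 1 by omega)]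
        have := hf (i - 1) (j - 1) (by omega) (by omega)
        exact ⟨this.1, this.2.trans (by omega)⟩
  · intro i hi hiq
    simp only [if_neg (show ¬ i = 0 by omega), if_pos (show i ≤ q + 1 by omega)]
    have := hl (i - 1) (by omega)
    omega

theorem UP.exists {V : Type*} {G : SimpleGraph V} {lev : V → ℕ} {par : V → V}
    (h1 : ∀ v w, G.Adj v w → lev v ≤ lev w + 1)
    (h2 : ∀ v, lev v ≠ 0 → G.Adj v (par v) ∧ lev (par v) + 1 = lev v)
    (h3 : ∀ v w, G.Reachable v w → lev v = 0 → lev w = 0 → v = w) (n : ℕ) :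
    ∀ x y, G.Reachable x y → lev x = n → lev y = n → ∃ q, UP G lev n x y q := by
  induction n with
  | zero =>
    intro x y hr hx hy
    obtain rfl := h3 x y hr hx hy
    exact ⟨0, UP.zero x⟩
  | succ n ih =>
    intro x y hr hx hy
    by_cases hxy : x = y
    · subst hxy
      exact ⟨0, UP.zero x⟩
    by_cases ha : G.Adj x y
    · exact ⟨1, UP.one ha⟩
    obtain ⟨px, lx⟩ := h2 x (by omega)
    obtain ⟨py, ly⟩ := h2 y (by omega)
    by_cases hb : G.Adj (par x) y
    · exact ⟨2, UP.two hxy ha px hb.symm (by omega)⟩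
    by_cases hc : G.Adj (par y) x
    · exact ⟨2, UP.two hxy ha hc.symm py (by omega)⟩
    obtain ⟨q, hq⟩ := ih (par x) (par y)
      (px.symm.reachable.trans (hr.trans py.reachable)) (by omega) (by omega)
    exact ⟨q + 2, UP.extend h1 hx hy (by omega) (by omega) px py hxy ha hb hc hq⟩

/-- The main descent. -/
theorem descent {V : Type*} {G : SimpleGraph V} {lev : V → ℕ} {par : V → V}
    (h1 : ∀ v w, G.Adj v w → lev v ≤ lev w + 1)
    (h2 : ∀ v, lev v ≠ 0 → G.Adj v (par v) ∧ lev (par v) + 1 = lev v)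
    (h3 : ∀ v w, G.Reachable v w → lev v = 0 → lev w = 0 → v = w) (l : ℕ) (hl : 2 ≤ l) (n : ℕ) :
    ∀ (t : ℕ) (a : ℕ → V), (∀ m ≤ n, ∀ c, ¬ OC G lev m (2 * l + 1) c) →
      (∀ j, a (j + (2 * l + 1)) = a j) → (∀ j, lev (a j) = n) →
      (∀ j k, G.Reachable (a j) (a k)) → 2 * t ≤ l →
      (∀ k q, UP G lev n (a k) (a (k + l)) q → q + 2 * t = l + 1) →
      (∀ k q, UP G lev n (a k) (a (k + 1)) q → 2 * l ≤ q + 2 * t) → False := by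
  induction n with
  | zero =>
    intro t a _ _ hlev hr ht hP1 _
    have := h3 (a 0) (a (0 + l)) (hr _ _) (hlev _) (hlev _)
    have := hP1 0 0 (this ▸ UP.zero _)
    omega
  | succ n ih =>
    intro t a hOC hper hlev hr ht hP1 hP2
    have hne : ∀ k, a k ≠ a (k + l) := fun k hk => by
      have := hP1 k 0 (hk ▸ UP.zero _)
      omega
    have hne1 : ∀ k, a k ≠ a (k + 1) := fun k hk => by
      have := hP2 k 0 (hk ▸ UP.zero _)
      omega
    have hna1 : ∀ k, ¬ G.Adj (a k) (a (k + 1)) := fun k hk => by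
      have := hP2 k 1 (UP.one hk)
      omega
    have hex : ∀ k, ∃ q, UP G lev (n + 1) (a k) (a (k + l)) q := fun k =>
      UP.exists h1 h2 h3 (n + 1) _ _ (hr _ _) (hlev _) (hlev _)
    by_cases ht1 : 2 * t = l
    · have hadj : ∀ k, G.Adj (a k) (a (k + l)) := by
        intro k
        obtain ⟨q, hq⟩ := hex k
        obtain rfl : q = 1 := by have := hP1 k q hq; omega
        obtain ⟨f, hf, f0, f1, -⟩ := hq
        rw [← f0, ← f1]
        exact (hf 0 1 (by omega) le_rfl).2.2 rfl
      have hper' : ∀ m j, a (j + m * (2 * l + 1)) = a j := by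
        intro m
        induction m with
        | zero => simp
        | succ m ihm => intro j; rw [← ihm j, ← hper (j + m * (2 * l + 1))]; congr 1; ring
      refine hOC (n + 1) le_rfl (fun m => a (m * l)) ⟨fun j => ?_, fun j => ?_, fun j => hlev _⟩
      · show a ((j + (2 * l + 1)) * l) = a (j * l)
        rw [← hper' l (j * l)]
        congr 1; ring
      · show G.Adj (a (j * l)) (a ((j + 1) * l))
        rw [add_mul, one_mul]
        exact hadj _
    have hna : ∀ k, ¬ G.Adj (a k) (a (k + l)) := fun k hk => by
      have := hP1 k 1 (UP.one hk)
      omega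
    by_cases ht2 : 2 * t + 1 = l
    · have hb : ∀ k, ∃ b, G.Adj (a k) b ∧ G.Adj (a (k + l)) b ∧ lev b = n := by
        intro k
        obtain ⟨q, hq⟩ := hex k
        obtain rfl : q = 2 := by have := hP1 k q hq; omega
        obtain ⟨f, hf, f0, f1, hlt⟩ := hq
        have e1 : G.Adj (a k) (f 1) := by
          rw [← f0]; exact (hf 0 1 (by omega) (by omega)).2.2 rfl
        have e2 : G.Adj (a (k + l)) (f 1) := by
          rw [← f1]; exact ((hf 1 2 (by omega) (by omega)).2.2 rfl).symm
        refine ⟨f 1, e1, e2, ?_⟩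
        have := hlt 1 (by omega) (by omega)
        have := h1 _ _ e1
        have := hlev k
        omega
      have hnc : ∀ k b, G.Adj (a k) b → G.Adj (a (k + 1)) b → lev b = n → False := by
        intro k b hb1 hb2 hb3
        have := hP2 k 2 (UP.two (hne1 k) (hna1 k) hb1 hb2 (by omega))
        omega
      obtain ⟨e, he1, he2, he3⟩ := hb (l + 1)
      obtain ⟨e', he1', he2', he3'⟩ := hb l
      have ha0 : a (l + 1 + l) = a 0 := by rw [← hper 0]; congr 1; ring
      rw [ha0] at he2
      have hn1 : ¬ G.Adj e (a l) := fun hh => hnc l e hh.symm he1 he3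
      have hn2 : ¬ G.Adj e' (a 0) := fun hh => by
        refine hnc (l + l) e' he2' ?_ he3'
        rw [show l + l + 1 = l + 1 + l by ring, ha0]
        exact hh.symm
      obtain ⟨q, hq⟩ := UP.exists h1 h2 h3 n e e'
        (he2.symm.reachable.trans ((hr 0 l).trans he1'.reachable)) he3 he3'
      have h00 := hne 0
      have h01 := hna 0
      have hP := hP1 0 (q + 2)
      rw [zero_add] at h00 h01 hP
      have := hP (UP.extend h1 (hlev 0) (hlev l) he3 he3' he2 he1' h00 h01 hn1 hn2 hq)
      obtain rfl : q = 0 := by omega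
      obtain ⟨f, -, f0, f1, -⟩ := hq
      rw [← f0, f1] at hn1
      exact hn1 he1'.symm
    have hpa : ∀ k, G.Adj (a k) (par (a k)) := fun k => (h2 (a k) (by rw [hlev]; omega)).1
    have hpl : ∀ k, lev (par (a k)) = n := fun k => by
      have := (h2 (a k) (by rw [hlev]; omega)).2
      rw [hlev] at this
      omega
    refine ih (t + 1) (fun j => par (a j)) (fun m hm => hOC m (by omega))
      (fun j => by simp only [hper]) hpl
      (fun j k => (hpa j).symm.reachable.trans ((hr j k).trans (hpa k).reachable)) (by omega) ?_ ?_
    · intro k q hq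
      have := hP1 k (q + 2) (UP.extend h1 (hlev _) (hlev _) (hpl _) (hpl _) (hpa _) (hpa _)
        (hne k) (hna k) (fun hh => ?_) (fun hh => ?_) hq)
      · omega
      · have := hP1 k 2 (UP.two (hne k) (hna k) (hpa k) hh.symm (by rw [hpl]; omega))
        omega
      · have := hP1 k 2 (UP.two (hne k) (hna k) hh.symm (hpa _) (by rw [hpl]; omega))
        omega
    · intro k q hq
      have := hP2 k (q + 2) (UP.extend h1 (hlev _) (hlev _) (hpl _) (hpl _) (hpa _) (hpa _)
        (hne1 k) (hna1 k) (fun hh => ?_) (fun hh => ?_) hq)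
      · omega
      · have := hP2 k 2 (UP.two (hne1 k) (hna1 k) (hpa k) hh.symm (by rw [hpl]; omega))
        omega
      · have := hP2 k 2 (UP.two (hne1 k) (hna1 k) hh.symm (hpa _) (by rw [hpl]; omega))
        omega

theorem OC.close {V : Type*} {G : SimpleGraph V} {lev : V → ℕ} {n d : ℕ} (g : ℕ → V)
    (hd : 0 < d) (hlev : ∀ m, lev (g m) = n) (hadj : ∀ m, m + 1 < d → G.Adj (g m) (g (m + 1)))
    (hlast : G.Adj (g (d - 1)) (g 0)) : OC G lev n d (fun m => g (m % d)) := by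
  refine ⟨fun j => by simp, fun j => ?_, fun j => hlev _⟩
  show G.Adj (g (j % d)) (g ((j + 1) % d))
  have hlt := Nat.mod_lt j hd
  rcases Nat.lt_or_ge (j % d + 1) d with h | h
  · have : (j + 1) % d = j % d + 1 := by
      rw [Nat.add_mod_eq_ite]
      have h1 : 1 % d = 1 := Nat.mod_eq_of_lt (by omega)
      rw [h1, if_neg (by omega)]
    rw [this]
    exact hadj _ h
  · have h0 : (j + 1) % d = 0 := by
      have e : j % d + 1 = d := by omega
      rw [Nat.add_mod, ← Nat.mod_add_mod, Nat.mod_mod, Nat.add_mod_mod, e, Nat.mod_self]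
    rw [h0, show j % d = d - 1 by omega]
    exact hlast

theorem OC.induced {V : Type*} {G : SimpleGraph V} {lev : V → ℕ} {n N : ℕ} {c : ℕ → V}
    (h : OC G lev n N c) (ho : Odd N) (hmin : ∀ N' < N, Odd N' → ∀ c', ¬ OC G lev n N' c') :
    ∀ j d, 0 < d → d < N →
      c j ≠ c (j + d) ∧ (G.Adj (c j) (c (j + d)) ↔ (d = 1 ∨ d + 1 = N)) := by
  obtain ⟨hper, hadj, hlev⟩ := h
  have eqodd : ∀ j d, Odd d → d < N → c j ≠ c (j + d) := by
    intro j d hd hdN he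
    have hd0 : 0 < d := hd.pos
    refine hmin d hdN hd _ (OC.close (fun m => c (j + m)) hd0 (fun m => hlev _)
      (fun m _ => hadj _) ?_)
    have := hadj (j + (d - 1))
    rw [show j + (d - 1) + 1 = j + d by omega, ← he] at this
    exact this
  have adjev : ∀ j d, Even d → d + 1 < N → ¬ G.Adj (c j) (c (j + d)) := by
    intro j d hd hdN ha
    exact hmin (d + 1) hdN hd.add_one _ (OC.close (fun m => c (j + m)) (by omega)
      (fun m => hlev _) (fun m _ => hadj _) ha.symm)
  have hwrap : ∀ j d, d < N → c (j + d + (N - d)) = c j := by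
    intro j d hd
    rw [← hper j]; congr 1; omega
  intro j d hd hdN
  refine ⟨?_, ?_, ?_⟩
  · intro he
    rcases Nat.even_or_odd d with hev | hod
    · refine eqodd (j + d) (N - d) (Nat.Odd.sub_even hdN.le ho hev) (by omega) ?_
      rw [hwrap j d hdN, he]
    · exact eqodd j d hod hdN he
  · intro ha
    by_contra hcon
    rcases Nat.even_or_odd d with hev | hod
    · exact adjev j d hev (by omega) ha
    · refine adjev (j + d) (N - d) (Nat.Odd.sub_odd ho hod) (by omega) ?_
      rw [hwrap j d hdN]
      exact ha.symm
  · rintro (rfl | hd1)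
    · exact hadj j
    · have := hadj (j + d)
      rw [show j + d + 1 = j + N by omega, hper] at this
      exact this.symm

theorem base {V : Type*} {G : SimpleGraph V} {lev : V → ℕ} {par : V → V} {l : ℕ} (hl : 2 ≤ l)
    (hG : G.MemGFamily l)
    (h1 : ∀ v w, G.Adj v w → lev v ≤ lev w + 1)
    (h2 : ∀ v, lev v ≠ 0 → G.Adj v (par v) ∧ lev (par v) + 1 = lev v)
    (h3 : ∀ v w, G.Reachable v w → lev v = 0 → lev w = 0 → v = w) (i : ℕ)
    (hlow : ∀ m < i, ∀ c, ¬ OC G lev m (2 * l + 1) c) (c : ℕ → V)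
    (hc : OC G lev i (2 * l + 1) c)
    (hi : ∀ j d, 0 < d → d < 2 * l + 1 →
      c j ≠ c (j + d) ∧ (G.Adj (c j) (c (j + d)) ↔ (d = 1 ∨ d + 1 = 2 * l + 1))) : False := by
  obtain ⟨hper, hadj, hlev⟩ := hc
  have hreach0 : ∀ j, G.Reachable (c 0) (c j) := by
    intro j
    induction j with
    | zero => exact Reachable.refl _
    | succ j ih => exact ih.trans (hadj j).reachable
  have hreach : ∀ j k, G.Reachable (c j) (c k) := fun j k => (hreach0 j).symm.trans (hreach0 k)
  have hi0 : i ≠ 0 := by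
    rintro rfl
    exact (hadj 0).ne (h3 _ _ (hreach _ _) (hlev _) (hlev _))
  obtain ⟨n, rfl⟩ : ∃ n, i = n + 1 := ⟨i - 1, by omega⟩
  have hpa : ∀ k, G.Adj (c k) (par (c k)) := fun k => (h2 (c k) (by rw [hlev]; omega)).1
  have hpl : ∀ k, lev (par (c k)) = n := fun k => by
    have := (h2 (c k) (by rw [hlev]; omega)).2
    rw [hlev] at this
    omega
  have harc : ∀ k s, s + 2 ≤ 2 * l + 1 → IP G s (fun m => c (k + m)) := by
    intro k s hs a b hab hb
    have := hi (k + a) (b - a) (by omega) (by omega)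
    rw [show k + a + (b - a) = k + b by omega] at this
    exact ⟨this.1, this.2.trans (by omega)⟩
  -- a vertex of level `n` has at most one neighbour on `c`
  have huniq' : ∀ v, lev v = n → ∀ d, 0 < d → d ≤ l → ∀ k, G.Adj v (c k) →
      ¬ G.Adj v (c (k + d)) := by
    intro v hv d
    induction d using Nat.strong_induction_on with
    | _ d ih =>
      intro hd hdl k hk hkd
      have hIC := glue (q := 0) (s := d) (f := fun _ => v) (g := fun m => c (k + m))
        (fun i j _ _ => by omega) (harc k d (by omega)) (by
          intro i _ j hj
          refine ⟨fun hh => ?_, ?_⟩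
          · have := hlev (k + j)
            rw [← hh] at this
            omega
          · constructor
            · intro ha
              by_contra hcon
              exact ih j (by omega) (by omega) (by omega) k hk ha
            · rintro (⟨_, rfl⟩ | ⟨_, rfl⟩)
              · exact hk
              · exact hkd)
      have := hIC.ge hG (by omega)
      omega
  have huniq : ∀ v, lev v = n → ∀ d, 0 < d → d < 2 * l + 1 → ∀ k, G.Adj v (c k) →
      ¬ G.Adj v (c (k + d)) := by
    intro v hv d hd hdl k hk hkd
    rcases Nat.lt_or_ge l d with h | h
    · refine huniq' v hv (2 * l + 1 - d) (by omega) (by omega) (k + d) hkd ?_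
      rw [show k + d + (2 * l + 1 - d) = k + (2 * l + 1) by omega, hper]
      exact hk
    · exact huniq' v hv d hd h k hk hkd
  have hB : ∀ k s q, 0 < s → s + 2 ≤ 2 * l + 1 → UP G lev n (par (c (k + s))) (par (c k)) q →
      q ≠ 0 ∧ ∃ F, IC G (q + s + 2) F := by
    intro k s q hs hs2 hq
    obtain ⟨f, hf, f0, fq, hlt⟩ := hq
    have hq0 : q ≠ 0 := by
      rintro rfl
      refine huniq (f 0) (by rw [f0, hpl]) s hs (by omega) k ?_ ?_
      · rw [fq]; exact (hpa _).symm
      · rw [f0]; exact (hpa _).symm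
    have hle : ∀ i ≤ q, lev (f i) ≤ n := by
      intro i hi
      rcases Nat.eq_zero_or_pos i with rfl | hi0
      · rw [f0, hpl]
      · rcases Nat.lt_or_ge i q with h | h
        · exact (hlt i hi0 h).le
        · obtain rfl : i = q := by omega
          rw [fq, hpl]
    refine ⟨hq0, _, glue hf (harc k s hs2) ?_⟩
    intro i hi j hj
    refine ⟨fun hh => ?_, ?_, ?_⟩
    · have := hle i hi
      rw [hh, hlev] at this
      omega
    · intro ha
      rcases Nat.eq_zero_or_pos i with rfl | hi0
      · right
        refine ⟨rfl, ?_⟩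
        by_contra hjs
        refine huniq (f 0) (by rw [f0, hpl]) (s - j) (by omega) (by omega) (k + j) ha ?_
        rw [show k + j + (s - j) = k + s by omega, f0]
        exact (hpa _).symm
      · rcases Nat.lt_or_ge i q with h | h
        · have e1 := hlt i hi0 h
          have e2 := h1 _ _ ha.symm
          rw [hlev] at e2
          omega
        · obtain rfl : i = q := by omega
          left
          refine ⟨rfl, ?_⟩
          by_contra hj0
          refine huniq (f i) (by rw [fq, hpl]) j (by omega) (by omega) k ?_ ha
          rw [fq]
          exact (hpa _).symm
    · rintro (⟨rfl, rfl⟩ | ⟨rfl, rfl⟩)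
      · rw [fq]
        exact (hpa _).symm
      · rw [f0]
        exact (hpa _).symm
  refine descent h1 h2 h3 l hl n 1 (fun j => par (c j)) (fun m hm => hlow m (by omega))
    (fun j => by simp only [hper]) hpl
    (fun j k => (hpa j).symm.reachable.trans ((hreach j k).trans (hpa k).reachable)) (by omega)
    ?_ ?_
  · intro k q hq
    obtain ⟨hq0, F, hF⟩ := hB k l q (by omega) (by omega) hq.symm
    obtain ⟨-, F', hF'⟩ := hB (k + l) (l + 1) q (by omega) (by omega) (by
      rw [show k + l + (l + 1) = k + (2 * l + 1) by ring, hper]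
      exact hq)
    have g1 := hF.ge hG (by omega)
    rcases Nat.even_or_odd (q + l + 2) with he | ho
    · have := hF'.eq hl hG (by omega) (by
        rw [show q + (l + 1) + 2 = q + l + 2 + 1 by ring]
        exact he.add_one)
      omega
    · have := hF.eq hl hG (by omega) ho
      omega
  · intro k q hq
    obtain ⟨hq0, F, hF⟩ := hB k 1 q (by omega) (by omega) hq.symm
    have g1 := hF.ge hG (by omega)
    omega

theorem no_odd {V : Type*} {G : SimpleGraph V} {lev : V → ℕ} {par : V → V} {l : ℕ} (hl : 2 ≤ l)
    (hG : G.MemGFamily l)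
    (h1 : ∀ v w, G.Adj v w → lev v ≤ lev w + 1)
    (h2 : ∀ v, lev v ≠ 0 → G.Adj v (par v) ∧ lev (par v) + 1 = lev v)
    (h3 : ∀ v w, G.Reachable v w → lev v = 0 → lev w = 0 → v = w) (i : ℕ) :
    ∀ N, Odd N → ∀ c, ¬ OC G lev i N c := by
  induction i using Nat.strong_induction_on with
  | _ i ih =>
    intro N
    induction N using Nat.strong_induction_on with
    | _ N ihN =>
      intro ho c hc
      have hind := hc.induced ho ihN
      have hN3 : 3 ≤ N := by
        have h1 : N ≠ 1 := by
          rintro rfl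
          exact (hc.2.1 0).ne (hc.1 0).symm
        obtain ⟨k, rfl⟩ := ho
        omega
      have hIC : IC G N c := by
        intro a b hab hb
        have := hind a (b - a) (by omega) (by omega)
        rw [show a + (b - a) = b by omega] at this
        refine ⟨this.1, this.2.trans ?_⟩
        omega
      obtain rfl := hIC.eq hl hG hN3 ho
      exact base hl hG h1 h2 h3 i (fun m hm => ih m hm _ ho) c hc hind

theorem exists_lev {V : Type*} (G : SimpleGraph V) : ∃ (lev : V → ℕ) (par : V → V),
    (∀ v w, G.Adj v w → lev v ≤ lev w + 1) ∧
    (∀ v, lev v ≠ 0 → G.Adj v (par v) ∧ lev (par v) + 1 = lev v) ∧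
    (∀ v w, G.Reachable v w → lev v = 0 → lev w = 0 → v = w) := by
  classical
  let rep : V → V := fun v => (G.connectedComponentMk v).out
  have hrep : ∀ v, G.Reachable (rep v) v := fun v =>
    ConnectedComponent.exact (Quot.out_eq (G.connectedComponentMk v))
  have hrepeq : ∀ v w, G.Reachable v w → rep v = rep w := fun v w h => by
    show (G.connectedComponentMk v).out = (G.connectedComponentMk w).out
    rw [ConnectedComponent.sound h]
  have hlip : ∀ v w, G.Adj v w → G.dist (rep v) v ≤ G.dist (rep w) w + 1 := by
    intro v w h
    rw [hrepeq v w h.reachable]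
    obtain ⟨p, hp⟩ := (hrep w).exists_walk_length_eq_dist
    have := dist_le (p.concat h.symm)
    rwa [Walk.length_concat, hp] at this
  have hpar : ∀ v, ∃ w, G.dist (rep v) v ≠ 0 →
      G.Adj v w ∧ G.dist (rep w) w + 1 = G.dist (rep v) v := by
    intro v
    by_cases h0 : G.dist (rep v) v = 0
    · exact ⟨v, fun h => absurd h0 h⟩
    obtain ⟨p, hp⟩ := (hrep v).symm.exists_walk_length_eq_dist
    rw [dist_comm] at hp
    generalize hr : rep v = r at *
    cases p with
    | nil => simp at h0
    | @cons _ w _ h q =>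
      refine ⟨w, fun _ => ⟨h, ?_⟩⟩
      have e : rep w = r := by rw [← hr]; exact hrepeq _ _ h.symm.reachable
      have e1 := dist_le q
      have e2 := hlip v w h
      rw [Walk.length_cons] at hp
      rw [hr, e] at e2
      rw [e]
      rw [dist_comm] at e1
      omega
  choose par hpar using hpar
  refine ⟨fun v => G.dist (rep v) v, par, hlip, hpar, ?_⟩
  intro v w hr hv hw
  have a := ((hrep v).dist_eq_zero_iff).1 hv
  have b := ((hrep w).dist_eq_zero_iff).1 hw
  rw [← a, ← b, hrepeq v w hr]

/-- every graph `G ∈ 𝒢_ℓ` with `ℓ ≥ 2` satisfies `χ(G) ≤ 4`. -/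
theorem stmt_2 {V : Type*} [Fintype V] (l : ℕ) (hl : 2 ≤ l) (G : SimpleGraph V)
    (hG : G.MemGFamily l) : G.chromaticNumber ≤ 4 := by
  obtain ⟨lev, par, h1, h2, h3⟩ := exists_lev G
  have hcol : ∀ i, (G.induce {v | lev v = i}).Colorable 2 := by
    intro i
    rw [two_colorable_iff_forall_loop_even]
    intro u w
    by_contra hodd
    rw [Nat.not_even_iff_odd] at hodd
    refine no_odd hl hG h1 h2 h3 i w.length hodd _
      (OC.close (fun m => (w.getVert m : V)) hodd.pos (fun m => (w.getVert m).2) ?_ ?_)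
    · intro m hm
      exact w.adj_getVert_succ (by omega)
    · have := w.adj_getVert_succ (i := w.length - 1) (by have := hodd.pos; omega)
      rw [show w.length - 1 + 1 = w.length by have := hodd.pos; omega, Walk.getVert_length] at this
      rw [Walk.getVert_zero]
      exact this
  have col : ∀ i, (G.induce {v | lev v = i}).Coloring (Fin 2) := fun i => (hcol i).some
  have C : G.Coloring (Fin 2 × Fin 2) := Coloring.mk
    (fun v => (⟨lev v % 2, Nat.mod_lt _ (by omega)⟩, col (lev v) ⟨v, rfl⟩)) (by
      intro v w hvw he
      rw [Prod.mk.injEq, Fin.mk.injEq] at he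
      obtain ⟨e1, e2⟩ := he
      have a := h1 _ _ hvw
      have b := h1 _ _ hvw.symm
      have e : lev w = lev v := by omega
      have key : ∀ (i : ℕ) (hv : lev v = i) (hw : lev w = i),
          col i ⟨v, hv⟩ ≠ col i ⟨w, hw⟩ := fun i hv hw => (col i).valid hvw
      have aux : ∀ (i : ℕ) (hw : lev w = i), col (lev w) ⟨w, rfl⟩ = col i ⟨w, hw⟩ := by
        rintro i rfl
        rfl
      have := aux (lev v) e
      exact key (lev v) rfl e (e2.trans this))
  have := C.colorable
  simp only [Fintype.card_prod, Fintype.card_fin] at this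
  exact_mod_cast this.chromaticNumber_le
end

section
/- Let G be a graph in 𝒢₂ such that no two distinct 5-cycles of G share an edge (equivalently, G induces no two 5-cycles sharing edges, since a graph of girth 5 has all its 5-cycles induced). Then the chromatic number of G satisfies χ(G) ≤ 3. -/
open SimpleGraph

/-- induced cycle given by a function on `0..n-1` -/
def IndCyc {V : Type*} (G : SimpleGraph V) (c : ℕ → V) (n : ℕ) : Prop :=
  ∀ i j, i < j → j < n → (c i ≠ c j ∧ (G.Adj (c i) (c j) ↔ (j = i + 1 ∨ (i = 0 ∧ j + 1 = n))))

/-- induced path given by a function on `0..k` -/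
def IndPath {V : Type*} (G : SimpleGraph V) (p : ℕ → V) (k : ℕ) : Prop :=
  ∀ i j, i < j → j ≤ k → (p i ≠ p j ∧ (G.Adj (p i) (p j) ↔ j = i + 1))

/-- the class of graphs, in elementary terms -/
structure Good {V : Type*} (G : SimpleGraph V) : Prop where
  tri : ∀ a b c, G.Adj a b → G.Adj b c → G.Adj c a → False
  quad : ∀ a b c d, G.Adj a b → G.Adj b c → G.Adj c d → G.Adj d a → a ≠ c → b ≠ d → False
  hole : ∀ n c, Odd n → 7 ≤ n → IndCyc G c n → False
  pent : ∀ a b c d e c' d' e', G.Adj a b → G.Adj b c → G.Adj c d → G.Adj d e → G.Adj e a →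
    G.Adj b c' → G.Adj c' d' → G.Adj d' e' → G.Adj e' a → c = c'

lemma walk_of_fun {V : Type*} (G : SimpleGraph V) (c : ℕ → V) (k : ℕ)
    (hadj : ∀ i < k, G.Adj (c i) (c (i+1))) (hinj : ∀ i j, i < j → j ≤ k → c i ≠ c j) :
    ∃ w : G.Walk (c 0) (c k), w.IsPath ∧ w.length = k ∧
      (∀ v, v ∈ w.support ↔ ∃ i ≤ k, v = c i) ∧
      (∀ e, e ∈ w.edges ↔ ∃ i < k, e = s(c i, c (i+1))) := by
  induction k with
  | zero => exact ⟨Walk.nil, by simp, by simp, by simp, by simp⟩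
  | succ k ih =>
    obtain ⟨w, hp, hl, hs, he⟩ := ih (fun i hi => hadj i (by omega))
      (fun i j hij hj => hinj i j hij (by omega))
    refine ⟨w.concat (hadj k (by omega)), ?_, ?_, ?_, ?_⟩
    · refine hp.concat ?_ _
      rw [hs]; rintro ⟨i, hi, h⟩
      exact hinj i (k+1) (by omega) le_rfl h.symm
    · simp [hl]
    · intro v
      rw [Walk.support_concat]
      simp only [List.concat_eq_append, List.mem_append, hs, List.mem_singleton]
      constructor
      · rintro (⟨i, hi, h⟩ | h)
        · exact ⟨i, by omega, h⟩
        · exact ⟨k+1, le_rfl, h⟩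
      · rintro ⟨i, hi, h⟩
        rcases Nat.lt_or_ge k i with h' | h'
        · right; obtain rfl : i = k+1 := by omega
          exact h
        · left; exact ⟨i, h', h⟩
    · intro e
      rw [Walk.edges_concat]
      simp only [List.concat_eq_append, List.mem_append, he, List.mem_singleton]
      constructor
      · rintro (⟨i, hi, h⟩ | h)
        · exact ⟨i, by omega, h⟩
        · exact ⟨k, by omega, h⟩
      · rintro ⟨i, hi, h⟩
        rcases Nat.lt_or_ge i k with h' | h'
        · left; exact ⟨i, h', h⟩
        · right; obtain rfl : i = k := by omega
          exact h

lemma cyc_of_fun {V : Type*} (G : SimpleGraph V) (c : ℕ → V) (k : ℕ) (hk : 2 ≤ k)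
    (hadj : ∀ i < k, G.Adj (c i) (c (i+1))) (hcl : G.Adj (c k) (c 0))
    (hinj : ∀ i j, i < j → j ≤ k → c i ≠ c j) :
    ∃ w : G.Walk (c k) (c k), w.IsCycle ∧ w.length = k + 1 ∧
      (∀ v, v ∈ w.support ↔ ∃ i ≤ k, v = c i) ∧
      (∀ e, e ∈ w.edges ↔ (e = s(c k, c 0) ∨ ∃ i < k, e = s(c i, c (i+1)))) := by
  obtain ⟨w, hp, hl, hs, he⟩ := walk_of_fun G c k hadj hinj
  refine ⟨Walk.cons hcl w, ?_, by simp [hl], ?_, ?_⟩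
  · rw [Walk.cons_isCycle_iff]
    refine ⟨hp, ?_⟩
    rw [he]
    rintro ⟨i, hi, h⟩
    rw [Sym2.eq_iff] at h
    rcases h with ⟨h, -⟩ | ⟨h1, h2⟩
    · exact hinj i k hi le_rfl h.symm
    · rcases Nat.eq_zero_or_pos i with rfl | hi'
      · exact hinj 1 k (by omega) le_rfl h1.symm
      · exact hinj 0 i hi' (by omega) h2
  · intro v
    simp only [Walk.support_cons, List.mem_cons, hs]
    constructor
    · rintro (h | h)
      · exact ⟨k, le_rfl, h⟩
      · exact h
    · exact Or.inr
  · intro e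
    simp only [Walk.edges_cons, List.mem_cons, he]

lemma good_of {V : Type*} (G : SimpleGraph V) (hG : G.MemGFamily 2)
    (h5 : ∀ (v₁ v₂ : V) (w₁ : G.Walk v₁ v₁) (w₂ : G.Walk v₂ v₂),
      w₁.IsCycle → w₂.IsCycle → w₁.length = 5 → w₂.length = 5 →
      (∃ e, e ∈ w₁.edges ∧ e ∈ w₂.edges) → (∀ e, e ∈ w₁.edges ↔ e ∈ w₂.edges)) : Good G := by
  obtain ⟨hg, hh⟩ := hG
  have hg' : (5 : ℕ∞) ≤ G.egirth := by rw [hg]; norm_num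
  rw [le_egirth] at hg'
  have htri : ∀ a b c, G.Adj a b → G.Adj b c → G.Adj c a → False := by
    intro a b c hab hbc hca
    obtain ⟨w, hw, hl, -⟩ := cyc_of_fun G (fun i => if i = 0 then a else if i = 1 then b else c) 2
      le_rfl (by intro i hi; interval_cases i <;> simp [*]) (by simpa using hca)
      (by intro i j hij hj; interval_cases j <;> interval_cases i <;> simp [hab.ne, hbc.ne, hca.ne'])
    have := hg' _ w hw
    rw [hl] at this
    norm_num at this
  have hq : ∀ a b c d, G.Adj a b → G.Adj b c → G.Adj c d → G.Adj d a → a ≠ c → b ≠ d → False := by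
    intro a b c d hab hbc hcd hda hac hbd
    obtain ⟨w, hw, hl, -⟩ := cyc_of_fun G (fun i => if i = 0 then a else if i = 1 then b else
      if i = 2 then c else d) 3
      (by norm_num) (by intro i hi; interval_cases i <;> simp [*]) (by simpa using hda)
      (by intro i j hij hj; interval_cases j <;> interval_cases i <;>
        simp [hab.ne, hbc.ne, hcd.ne, hda.ne', hac, hbd])
    have := hg' _ w hw
    rw [hl] at this
    norm_num at this
  have h5c : ∀ a b c d e, G.Adj a b → G.Adj b c → G.Adj c d → G.Adj d e → G.Adj e a →
      ∃ (v : V) (w : G.Walk v v), w.IsCycle ∧ w.length = 5 ∧ ∀ f, f ∈ w.edges ↔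
        (f = s(a,b) ∨ f = s(b,c) ∨ f = s(c,d) ∨ f = s(d,e) ∨ f = s(e,a)) := by
    intro a b c d e hab hbc hcd hde hea
    have hac : a ≠ c := by rintro rfl; exact htri _ _ _ hcd hde hea
    have hbd : b ≠ d := by rintro rfl; exact htri _ _ _ hab hde hea
    have hce : c ≠ e := by rintro rfl; exact htri _ _ _ hab hbc hea
    have hda : a ≠ d := by rintro rfl; exact htri _ _ _ hab hbc hcd
    have heb : b ≠ e := by rintro rfl; exact htri _ _ _ hbc hcd hde
    obtain ⟨w, hw, hl, -, he⟩ := cyc_of_fun G (fun i => if i = 0 then a else if i = 1 then b else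
      if i = 2 then c else if i = 3 then d else e) 4
      (by norm_num) (by intro i hi; interval_cases i <;> simp [*]) (by simpa using hea)
      (by intro i j hij hj; interval_cases j <;> interval_cases i <;>
        simp [hab.ne, hbc.ne, hcd.ne, hde.ne, hea.ne', hac, hbd, hce, hda, heb])
    refine ⟨_, w, hw, hl, ?_⟩
    intro f
    rw [he]
    constructor
    · rintro (h | ⟨i, hi, h⟩)
      · simp at h; simp [h]
      · interval_cases i <;> simp at h <;> simp [h]
    · rintro (h | h | h | h | h)
      · right; exact ⟨0, by norm_num, by simpa using h⟩
      · right; exact ⟨1, by norm_num, by simpa using h⟩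
      · right; exact ⟨2, by norm_num, by simpa using h⟩
      · right; exact ⟨3, by norm_num, by simpa using h⟩
      · left; simpa using h
  refine ⟨htri, hq, ?_, ?_⟩
  · intro n c hodd hn hc
    obtain ⟨k, rfl⟩ : ∃ k, n = k + 1 := ⟨n - 1, by omega⟩
    obtain ⟨w, hw, hl, hs, he⟩ := cyc_of_fun G c k (by omega)
      (fun i hi => ((hc i (i+1) (by omega) (by omega)).2).2 (Or.inl rfl))
      (((hc 0 k (by omega) (by omega)).2).2 (Or.inr ⟨rfl, rfl⟩)).symm
      (fun i j hij hj => (hc i j hij (by omega)).1)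
    refine hh (k+1) hodd hn ⟨by omega, _, w, hw, ?_, hl⟩
    have key : ∀ i j, i < j → j ≤ k → G.Adj (c i) (c j) → w.toSubgraph.Adj (c i) (c j) := by
      intro i j hij hj h
      rw [← Subgraph.mem_edgeSet, Walk.mem_edges_toSubgraph, he]
      rcases ((hc i j hij (by omega)).2).1 h with rfl | ⟨rfl, h2⟩
      · right; exact ⟨i, by omega, rfl⟩
      · left; obtain rfl : j = k := by omega
        exact Sym2.eq_swap
    intro u hu v hv huv
    rw [Walk.mem_verts_toSubgraph, hs] at hu hv
    obtain ⟨i, hi, rfl⟩ := hu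
    obtain ⟨j, hj, rfl⟩ := hv
    rcases lt_trichotomy i j with h | h | h
    · exact key i j h hj huv
    · subst h; exact absurd rfl huv.ne
    · exact (key j i h hi huv.symm).symm
  · intro a b c d e c' d' e' hab hbc hcd hde hea hbc' hcd' hde' hea'
    obtain ⟨v, w, hw, hl, he⟩ := h5c a b c d e hab hbc hcd hde hea
    obtain ⟨v', w', hw', hl', he'⟩ := h5c a b c' d' e' hab hbc' hcd' hde' hea'
    have := (h5 v v' w w' hw hw' hl hl' ⟨s(a,b), (he _).2 (by simp), (he' _).2 (by simp)⟩ s(b,c)).1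
      ((he _).2 (by simp))
    rw [he'] at this
    have hac : a ≠ c := by rintro rfl; exact htri _ _ _ hcd hde hea
    have hbd : b ≠ d' := by rintro rfl; exact htri _ _ _ hab hde' hea'
    have heb : b ≠ e' := by rintro rfl; exact htri _ _ _ hbc' hcd' hde'
    have := hab.ne'
    have := hbc'.ne
    simp only [Sym2.eq_iff] at *
    grind

lemma fun_of_rtg {V : Type*} (G : SimpleGraph V) (S : Set V) {u v : V} (hu : u ∈ S)
    (h : Relation.ReflTransGen (fun a b => G.Adj a b ∧ a ∈ S ∧ b ∈ S) u v) :
    ∃ (k : ℕ) (p : ℕ → V), p 0 = u ∧ p k = v ∧ (∀ i < k, G.Adj (p i) (p (i+1))) ∧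
      (∀ i ≤ k, p i ∈ S) := by
  induction h with
  | refl => exact ⟨0, fun _ => u, rfl, rfl, by simp, by simp [hu]⟩
  | @tail b c _ hbc ih =>
    obtain ⟨k, p, h0, hk, ha, hS⟩ := ih
    refine ⟨k+1, fun t => if t ≤ k then p t else c, by simp [h0], by simp, ?_, ?_⟩
    · intro i hi
      rcases Nat.lt_or_ge i k with h | h
      · have h1 : i ≤ k := by omega
        have h2 : i + 1 ≤ k := by omega
        simpa [h1, h2] using ha i h
      · obtain rfl : i = k := by omega
        simpa [hk] using hbc.1
    · intro i hi
      by_cases h : i ≤ k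
      · simpa [h] using hS i h
      · simpa [h] using hbc.2.2

lemma shortest {V : Type*} (G : SimpleGraph V) (S : Set V) (P Q : V → Prop) {u v : V} (hu : u ∈ S)
    (hP : P u) (hQ : Q v)
    (h : Relation.ReflTransGen (fun a b => G.Adj a b ∧ a ∈ S ∧ b ∈ S) u v) :
    ∃ (k : ℕ) (p : ℕ → V), P (p 0) ∧ Q (p k) ∧ (∀ i ≤ k, p i ∈ S) ∧ IndPath G p k ∧
      (∀ i, 0 < i → i ≤ k → ¬ P (p i)) ∧ (∀ i < k, ¬ Q (p i)) := by
  classical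
  have hex : ∃ k, ∃ p : ℕ → V, P (p 0) ∧ Q (p k) ∧ (∀ i < k, G.Adj (p i) (p (i+1))) ∧
      (∀ i ≤ k, p i ∈ S) := by
    obtain ⟨k, p, h0, hk, ha, hS⟩ := fun_of_rtg G S hu h
    exact ⟨k, p, by rwa [h0], by rwa [hk], ha, hS⟩
  obtain ⟨k, ⟨p, h0, hk, ha, hS⟩, hmin⟩ :
      ∃ k, (∃ p : ℕ → V, P (p 0) ∧ Q (p k) ∧ (∀ i < k, G.Adj (p i) (p (i+1))) ∧
      (∀ i ≤ k, p i ∈ S)) ∧ ∀ m < k, ¬ ∃ p : ℕ → V, P (p 0) ∧ Q (p m) ∧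
        (∀ i < m, G.Adj (p i) (p (i+1))) ∧ (∀ i ≤ m, p i ∈ S) :=
    ⟨Nat.find hex, Nat.find_spec hex, fun m hm => Nat.find_min hex hm⟩
  -- splicing: jump from `i` to `i+1+d`
  have splice : ∀ i d, 0 < d → i + 1 + d ≤ k → G.Adj (p i) (p (i+1+d)) → False := by
    intro i d hd hid hadj
    refine hmin (k - d) (by omega) ⟨fun t => if t ≤ i then p t else p (t + d), ?_, ?_, ?_, ?_⟩
    · simpa using h0
    · have : ¬ (k - d ≤ i) := by omega
      have h2 : k - d + d = k := by omega
      simpa [this, h2] using hk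
    · intro t ht
      rcases lt_trichotomy t i with h | h | h
      · have h1 : t ≤ i := by omega
        have h2 : t + 1 ≤ i := by omega
        simpa [h1, h2] using ha t (by omega)
      · subst h; simpa using hadj
      · have h1 : ¬ t ≤ i := by omega
        have h2 : ¬ t + 1 ≤ i := by omega
        have := ha (t + d) (by omega)
        rw [show t + d + 1 = t + 1 + d by omega] at this
        simpa [h1, h2] using this
    · intro t ht
      by_cases h : t ≤ i
      · simpa [h] using hS t (by omega)
      · simpa [h] using hS (t + d) (by omega)
  have trunc : ∀ i < k, ¬ Q (p i) := fun i hi hq =>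
    hmin i hi ⟨p, h0, hq, fun t ht => ha t (by omega), fun t ht => hS t (by omega)⟩
  refine ⟨k, p, h0, hk, hS, ?_, ?_, trunc⟩
  · intro i j hij hj
    refine ⟨?_, ?_, ?_⟩
    · intro heq
      rcases Nat.lt_or_ge j k with h | h
      · refine splice i (j - i) (by omega) (by omega) ?_
        rw [heq, show i + 1 + (j - i) = j + 1 by omega]
        exact ha j h
      · obtain rfl : j = k := by omega
        exact trunc i hij (heq ▸ hk)
    · intro hadj
      by_contra hne
      refine splice i (j - i - 1) (by omega) (by omega) ?_
      rwa [show i + 1 + (j - i - 1) = j by omega]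
    · rintro rfl
      exact ha i (by omega)
  · intro i hi hik hp
    refine hmin (k - i) (by omega) ⟨fun t => p (t + i), by simpa using hp, ?_, ?_, ?_⟩
    · have : k - i + i = k := by omega
      simpa [this] using hk
    · intro t ht
      have := ha (t + i) (by omega)
      rw [show t + i + 1 = t + 1 + i by omega] at this
      simpa using this
    · intro t ht
      exact hS (t + i) (by omega)

lemma odd_indcyc {V : Type*} (G : SimpleGraph V) (S : Set V)
    (h : ∃ (n : ℕ) (c : ℕ → V), Odd n ∧ c n = c 0 ∧ (∀ i < n, G.Adj (c i) (c (i+1))) ∧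
      (∀ i ≤ n, c i ∈ S)) :
    ∃ (n : ℕ) (c : ℕ → V), Odd n ∧ 3 ≤ n ∧ IndCyc G c n ∧ (∀ i ≤ n, c i ∈ S) := by
  classical
  obtain ⟨n, ⟨c, hodd, hcl, ha, hS⟩, hmin⟩ :
      ∃ n, (∃ (c : ℕ → V), Odd n ∧ c n = c 0 ∧ (∀ i < n, G.Adj (c i) (c (i+1))) ∧
      (∀ i ≤ n, c i ∈ S)) ∧ ∀ m < n, ¬ (∃ (c : ℕ → V), Odd m ∧ c m = c 0 ∧
        (∀ i < m, G.Adj (c i) (c (i+1))) ∧ (∀ i ≤ m, c i ∈ S)) :=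
    ⟨Nat.find h, Nat.find_spec h, fun m hm => Nat.find_min h hm⟩
  have outer : ∀ i d, 0 < d → i + 1 + d ≤ n → Odd (n - d) → G.Adj (c i) (c (i+1+d)) → False := by
    intro i d hd hid ho hadj
    refine hmin (n - d) (by omega) ⟨fun t => if t ≤ i then c t else c (t + d), ho, ?_, ?_, ?_⟩
    · have : ¬ (n - d ≤ i) := by omega
      have h2 : n - d + d = n := by omega
      simpa [this, h2] using hcl
    · intro t ht
      rcases lt_trichotomy t i with h | h | h
      · have h1 : t ≤ i := by omega
        have h2 : t + 1 ≤ i := by omega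
        simpa [h1, h2] using ha t (by omega)
      · subst h; simpa using hadj
      · have h1 : ¬ t ≤ i := by omega
        have h2 : ¬ t + 1 ≤ i := by omega
        have := ha (t + d) (by omega)
        rw [show t + d + 1 = t + 1 + d by omega] at this
        simpa [h1, h2] using this
    · intro t ht
      by_cases h : t ≤ i
      · simpa [h] using hS t (by omega)
      · simpa [h] using hS (t + d) (by omega)
  have inner : ∀ i m, i + m ≤ n → m + 1 < n → Odd (m + 1) → G.Adj (c (i + m)) (c i) → False := by
    intro i m him hm ho hadj
    refine hmin (m+1) hm ⟨fun t => if t ≤ m then c (i + t) else c i, ho, by simp, ?_, ?_⟩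
    · intro t ht
      rcases Nat.lt_or_ge t m with h | h
      · have h1 : t ≤ m := by omega
        have h2 : t + 1 ≤ m := by omega
        simpa [h1, h2, add_assoc] using ha (i + t) (by omega)
      · obtain rfl : t = m := by omega
        simpa using hadj
    · intro t ht
      by_cases h : t ≤ m
      · simpa [h] using hS (i + t) (by omega)
      · simpa [h] using hS i (by omega)
  have hn1 : n ≠ 1 := by
    rintro rfl
    have := ha 0 (by omega)
    rw [zero_add, hcl] at this
    exact this.ne rfl
  have hn3 : 3 ≤ n := by
    rcases hodd with ⟨r, rfl⟩; omega
  refine ⟨n, c, hodd, hn3, ?_, hS⟩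
  intro i j hij hj
  refine ⟨?_, ?_, ?_⟩
  · intro heq
    rcases Nat.even_or_odd (j - i) with he | ho
    · refine outer i (j - i) (by omega) (by omega) ?_ ?_
      · rcases hodd with ⟨r, rfl⟩; rcases he with ⟨s, hs⟩; exact ⟨r - s, by omega⟩
      · rw [heq, show i + 1 + (j - i) = j + 1 by omega]
        exact ha j hj
    · have hne : j ≠ i + 1 := by
        rintro rfl
        exact (ha i (by omega)).ne heq
      refine inner i (j - i - 1) (by omega) (by omega) ?_ ?_
      · rwa [show j - i - 1 + 1 = j - i by omega]
      · rw [heq, show i + (j - i - 1) = j - 1 by omega]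
        have := ha (j - 1) (by omega)
        rwa [show j - 1 + 1 = j by omega] at this
  · intro hadj
    by_contra hne
    push Not at hne
    rcases Nat.even_or_odd (j - i) with he | ho
    · refine inner i (j - i) (by omega) (by omega) he.add_one ?_
      rw [show i + (j - i) = j by omega]
      exact hadj.symm
    · refine outer i (j - i - 1) (by omega) (by omega) ?_ ?_
      · rcases hodd with ⟨r, rfl⟩; rcases ho with ⟨s, hs⟩; exact ⟨r - s, by omega⟩
      · rwa [show i + 1 + (j - i - 1) = j by omega]
  · rintro (rfl | ⟨rfl, rfl⟩)
    · exact ha i (by omega)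
    · have := ha j (by omega)
      rw [hcl] at this
      exact this.symm

lemma IndPath.rev {V : Type*} {G : SimpleGraph V} {p : ℕ → V} {k : ℕ} (h : IndPath G p k) :
    IndPath G (fun t => p (k - t)) k := by
  intro i j hij hj
  have := h (k - j) (k - i) (by omega) (by omega)
  refine ⟨this.1.symm, ?_⟩
  rw [G.adj_comm, this.2]
  omega

lemma IndPath.tail {V : Type*} {G : SimpleGraph V} {p : ℕ → V} {k : ℕ} (h : IndPath G p (k+1)) :
    IndPath G (fun t => p (t + 1)) k := by
  intro i j hij hj
  have := h (i + 1) (j + 1) (by omega) (by omega)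
  refine ⟨this.1, ?_⟩
  rw [this.2]
  omega

lemma IndPath.join {V : Type*} {G : SimpleGraph V} {p q : ℕ → V} {k l : ℕ} (hp : IndPath G p k)
    (hq : IndPath G q l)
    (h : ∀ i j, i ≤ k → j ≤ l → p i ≠ q j ∧ (G.Adj (p i) (q j) ↔ (i = k ∧ j = 0))) :
    IndPath G (fun t => if t ≤ k then p t else q (t - (k+1))) (k + 1 + l) := by
  intro i j hij hj
  by_cases hi : i ≤ k
  · by_cases hjk : j ≤ k
    · simpa [hi, hjk] using hp i j hij hjk
    · have := h i (j - (k+1)) hi (by omega)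
      simp only [hi, hjk, if_true, if_false]
      refine ⟨this.1, ?_⟩
      rw [this.2]; omega
  · have hjk : ¬ j ≤ k := by omega
    have := hq (i - (k+1)) (j - (k+1)) (by omega) (by omega)
    simp only [hi, hjk, if_false]
    refine ⟨this.1, ?_⟩
    rw [this.2]; omega

lemma two_close {V : Type*} {G : SimpleGraph V} {p q : ℕ → V} {k l : ℕ} (hp : IndPath G p k)
    (hq : IndPath G q l) (hkl : 1 ≤ k + l)
    (h : ∀ i j, i ≤ k → j ≤ l → p i ≠ q j ∧
      (G.Adj (p i) (q j) ↔ ((i = k ∧ j = 0) ∨ (i = 0 ∧ j = l)))) :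
    IndCyc G (fun t => if t ≤ k then p t else q (t - (k+1))) (k + l + 2) := by
  intro i j hij hj
  by_cases hi : i ≤ k
  · by_cases hjk : j ≤ k
    · have := hp i j hij hjk
      simp only [hi, hjk, if_true]
      refine ⟨this.1, ?_⟩
      rw [this.2]; omega
    · have := h i (j - (k+1)) hi (by omega)
      simp only [hi, hjk, if_true, if_false]
      refine ⟨this.1, ?_⟩
      rw [this.2]; omega
  · have hjk : ¬ j ≤ k := by omega
    have := hq (i - (k+1)) (j - (k+1)) (by omega) (by omega)
    simp only [hi, hjk, if_false]
    refine ⟨this.1, ?_⟩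
    rw [this.2]; omega

/-- an induced pentagon inside `S` -/
structure Pent {V : Type*} (G : SimpleGraph V) (S : Set V) (x : ZMod 5 → V) : Prop where
  inj : ∀ i j, x i = x j → i = j
  adj : ∀ i j, G.Adj (x i) (x j) ↔ (j = i + 1 ∨ i = j + 1)
  mem : ∀ i, x i ∈ S

/-- the vertices of `S` outside the pentagon -/
def Out {V : Type*} (S : Set V) (x : ZMod 5 → V) : Set V := {v | v ∈ S ∧ ∀ m, v ≠ x m}

/-- the vertices of `S` outside the pentagon without neighbours on it -/
def Far {V : Type*} (G : SimpleGraph V) (S : Set V) (x : ZMod 5 → V) : Set V :=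
  {v | v ∈ Out S x ∧ ∀ m, ¬ G.Adj v (x m)}

lemma z5 : ∀ i j : ZMod 5, j = i ∨ j = i + 1 ∨ i = j + 1 ∨ j = i + 2 ∨ i = j + 2 := by decide

section
variable {V : Type*} {G : SimpleGraph V} {S : Set V} {x : ZMod 5 → V}

lemma Pent.uniq (hx : Pent G S x) (hG : Good G) {v : V} (hv : v ∈ Out S x) {i j : ZMod 5}
    (hi : G.Adj v (x i)) (hj : G.Adj v (x j)) : j = i := by
  have key : ∀ i, G.Adj v (x i) → G.Adj v (x (i+2)) → False := by
    intro i hi hj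
    refine hG.quad v (x i) (x (i+1)) (x (i+2)) hi ((hx.adj _ _).2 (Or.inl rfl))
      ((hx.adj _ _).2 (Or.inl (by ring))) hj.symm (hv.2 _) ?_
    intro h
    have := hx.inj _ _ h
    have z : ∀ i : ZMod 5, i ≠ i + 2 := by decide
    exact z i this
  have key1 : ∀ i, G.Adj v (x i) → G.Adj v (x (i+1)) → False := by
    intro i hi hj
    exact hG.tri v (x i) (x (i+1)) hi ((hx.adj _ _).2 (Or.inl rfl)) hj.symm
  rcases z5 i j with h | h | h | h | h
  · exact h
  · subst h; exact (key1 _ hi hj).elim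
  · subst h; exact (key1 _ hj hi).elim
  · subst h; exact (key _ hi hj).elim
  · subst h; exact (key _ hj hi).elim

lemma Pent.nadj (hx : Pent G S x) (hG : Good G) {u v : V} (hu : u ∈ Out S x) (hv : v ∈ Out S x)
    (huv : G.Adj u v) {i j : ZMod 5} (hi : G.Adj u (x i)) (hj : G.Adj v (x j)) : False := by
  have key1 : ∀ i u v, u ∈ Out S x → v ∈ Out S x → G.Adj u v → G.Adj u (x i) →
      G.Adj v (x (i+1)) → False := by
    intro i u v hu hv huv hi hj
    exact hG.quad u (x i) (x (i+1)) v hi ((hx.adj _ _).2 (Or.inl rfl)) hj.symm huv.symm (hu.2 _)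
      (hv.2 _).symm
  have key2 : ∀ i u v, u ∈ Out S x → v ∈ Out S x → G.Adj u v → G.Adj u (x i) →
      G.Adj v (x (i+2)) → False := by
    intro i u v hu hv huv hi hj
    refine hu.2 (i+4) (hG.pent (x (i+1)) (x i) u v (x (i+2)) (x (i+4)) (x (i+3)) (x (i+2))
      ?_ hi.symm huv hj ?_ ?_ ?_ ?_ ?_) <;>
    · rw [hx.adj]
      clear hi hj
      revert i; decide
  rcases z5 i j with h | h | h | h | h
  · subst h; exact hG.tri u v _ huv hj hi.symm
  · subst h; exact key1 _ _ _ hu hv huv hi hj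
  · subst h; exact key1 _ _ _ hv hu huv.symm hj hi
  · subst h; exact key2 _ _ _ hu hv huv hi hj
  · subst h; exact key2 _ _ _ hv hu huv.symm hj hi

lemma IndPath.mono {p : ℕ → V} {k l : ℕ} (h : IndPath G p k) (hl : l ≤ k) : IndPath G p l :=
  fun i j hij hj => h i j hij (hj.trans hl)

lemma Pent.arc (hx : Pent G S x) (a e : ZMod 5) (he : e = 1 ∨ e = -1) :
    IndPath G (fun t : ℕ => x (a + (t : ZMod 5) * e)) 3 := by
  intro i j hij hj
  have h1 : ∀ a e : ZMod 5, (e = 1 ∨ e = -1) → ∀ j : ℕ, j ≤ 3 → ∀ i : ℕ, i < j →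
    (a + (i : ZMod 5) * e) ≠ (a + (j : ZMod 5) * e) := by decide
  have h2 : ∀ a e : ZMod 5, (e = 1 ∨ e = -1) → ∀ j : ℕ, j ≤ 3 → ∀ i : ℕ, i < j →
    (((a + (j : ZMod 5) * e) = (a + (i : ZMod 5) * e) + 1 ∨
    (a + (i : ZMod 5) * e) = (a + (j : ZMod 5) * e) + 1) ↔ j = i + 1) := by decide
  refine ⟨fun h => h1 a e he j hj i hij (hx.inj _ _ h), ?_⟩
  simp only [hx.adj]
  exact h2 a e he j hj i hij

lemma Pent.odd_len (hx : Pent G S x) (hG : Good G) {p : ℕ → V} {k : ℕ} (hp : IndPath G p k)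
    (hk : 2 ≤ k) (hO : ∀ t ≤ k, p t ∈ Out S x) {i d : ZMod 5} (hd : d = 1 ∨ d = -1)
    (h : ∀ t ≤ k, ∀ m, m ≠ i + d →
      (G.Adj (p t) (x m) ↔ ((t = k ∧ m = i + 2 * d) ∨ (t = 0 ∧ m = i)))) : Odd k := by
  by_contra hodd
  rw [Nat.not_odd_iff_even] at hodd
  refine hG.hole (k + 3 + 2) _ ?_ (by omega) (two_close hp (hx.arc (i + 2*d) d hd) (by omega) ?_)
  · obtain ⟨r, rfl⟩ := hodd
    exact ⟨r + 2, by omega⟩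
  · intro t s ht hs
    refine ⟨(hO t ht).2 _, ?_⟩
    have h1 : ∀ i d : ZMod 5, (d = 1 ∨ d = -1) → ∀ s : ℕ, s ≤ 3 → i + 2 * d + (s : ZMod 5) * d ≠ i + d := by
      decide
    have h2 : ∀ i d : ZMod 5, (d = 1 ∨ d = -1) → ∀ s : ℕ, s ≤ 3 →
      ((i + 2 * d + (s : ZMod 5) * d = i + 2 * d ↔ s = 0) ∧
       (i + 2 * d + (s : ZMod 5) * d = i ↔ s = 3)) := by
      decide
    rw [h t ht _ (h1 i d hd s hs), (h2 i d hd s hs).1, (h2 i d hd s hs).2]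

lemma Pent.f3 (hx : Pent G S x) (hG : Good G) {p : ℕ → V} {k : ℕ} (hp : IndPath G p k)
    (hO : ∀ t ≤ k, p t ∈ Out S x) {i d : ZMod 5} (hd : d = 1 ∨ d = -1)
    (h0 : G.Adj (p 0) (x i)) (hk : G.Adj (p k) (x (i + 2 * d)))
    (hm : ∀ t, 0 < t → t < k → ∀ m, ¬ G.Adj (p t) (x m)) : False := by
  have hid : ∀ i d : ZMod 5, (d = 1 ∨ d = -1) → i + 2 * d ≠ i := by decide
  have hk0 : k ≠ 0 := by
    rintro rfl
    exact hid i d hd (hx.uniq hG (hO 0 le_rfl) h0 hk)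
  have hk1 : k ≠ 1 := by
    rintro rfl
    exact hx.nadj hG (hO 0 (by omega)) (hO 1 le_rfl)
      (((hp 0 1 (by omega) le_rfl).2).2 rfl) h0 hk
  have hadj : ∀ t ≤ k, ∀ m,
      (G.Adj (p t) (x m) ↔ ((t = k ∧ m = i + 2 * d) ∨ (t = 0 ∧ m = i))) := by
    intro t ht m
    constructor
    · intro h
      rcases Nat.eq_zero_or_pos t with rfl | h1
      · exact Or.inr ⟨rfl, hx.uniq hG (hO 0 (by omega)) h0 h⟩
      · rcases Nat.lt_or_ge t k with h2 | h2
        · exact (hm t h1 h2 m h).elim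
        · obtain rfl : t = k := by omega
          exact Or.inl ⟨rfl, hx.uniq hG (hO _ le_rfl) hk h⟩
    · rintro (⟨rfl, rfl⟩ | ⟨rfl, rfl⟩)
      · exact hk
      · exact h0
  have hodd := hx.odd_len hG hp (by omega) hO hd (fun t ht m _ => hadj t ht m)
  refine hG.hole (k + 2 + 2) _ ?_ ?_ (two_close hp
    ((hx.arc (i + 2*d) (-d) (by rcases hd with rfl | rfl <;> simp)).mono (by omega : 2 ≤ 3))
    (by omega) ?_)
  · obtain ⟨r, rfl⟩ := hodd
    exact ⟨r + 2, by omega⟩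
  · obtain ⟨r, rfl⟩ := hodd
    omega
  · intro t s ht hs
    refine ⟨(hO t ht).2 _, ?_⟩
    have h2 : ∀ i d : ZMod 5, (d = 1 ∨ d = -1) → ∀ s : ℕ, s ≤ 2 →
      ((i + 2 * d + (s : ZMod 5) * (-d) = i + 2 * d ↔ s = 0) ∧
       (i + 2 * d + (s : ZMod 5) * (-d) = i ↔ s = 2)) := by
      decide
    rw [hadj t ht, (h2 i d hd s hs).1, (h2 i d hd s hs).2]

/-- `i` is a label of `v` -/
def Lab (G : SimpleGraph V) (S : Set V) (x : ZMod 5 → V) (v : V) (i : ZMod 5) : Prop :=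
  ∃ u, u ∈ Out S x ∧ G.Adj u (x i) ∧
    Relation.ReflTransGen (fun a b => G.Adj a b ∧ a ∈ Far G S x ∧ b ∈ Out S x) v u

lemma lab_att {v : V} {i : ZMod 5} (hv : v ∈ Out S x) (h : G.Adj v (x i)) : Lab G S x v i :=
  ⟨v, hv, h, Relation.ReflTransGen.refl⟩

lemma lab_step {u v : V} {i : ZMod 5} (hu : u ∈ Far G S x) (hv : v ∈ Out S x) (h : G.Adj u v)
    (hl : Lab G S x v i) : Lab G S x u i := by
  obtain ⟨w, hw, hwi, hr⟩ := hl
  exact ⟨w, hw, hwi, Relation.ReflTransGen.head ⟨h, hu, hv⟩ hr⟩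

lemma Pent.lab_of_att (hx : Pent G S x) (hG : Good G) {v : V} {i j : ZMod 5} (hv : v ∈ Out S x)
    (h : G.Adj v (x i)) (hl : Lab G S x v j) : j = i := by
  obtain ⟨w, hw, hwi, hr⟩ := hl
  rcases Relation.ReflTransGen.cases_head hr with rfl | ⟨c, hc, -⟩
  · exact hx.uniq hG hv h hwi
  · exact (hc.2.1.2 _ h).elim

lemma far_rtg {u v : V} (hu : u ∈ Out S x)
    (h : Relation.ReflTransGen (fun a b => G.Adj a b ∧ a ∈ Far G S x ∧ b ∈ Out S x) v u)
    (T : Set V) (hT : Far G S x ⊆ T) (huT : u ∈ T) :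
    v ∈ T ∧ Relation.ReflTransGen (fun a b => G.Adj a b ∧ a ∈ T ∧ b ∈ T) v u := by
  induction h using Relation.ReflTransGen.head_induction_on with
  | refl => exact ⟨huT, Relation.ReflTransGen.refl⟩
  | head hab _ ih => exact ⟨hT hab.2.1, Relation.ReflTransGen.head ⟨hab.1, hT hab.2.1, ih.1⟩ ih.2⟩

lemma rtg_symm {T : Set V} {u v : V}
    (h : Relation.ReflTransGen (fun a b => G.Adj a b ∧ a ∈ T ∧ b ∈ T) u v) :
    Relation.ReflTransGen (fun a b => G.Adj a b ∧ a ∈ T ∧ b ∈ T) v u := by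
  induction h with
  | refl => exact Relation.ReflTransGen.refl
  | tail _ hbc ih => exact Relation.ReflTransGen.head ⟨hbc.1.symm, hbc.2.2, hbc.2.1⟩ ih

lemma z5d : ∀ i j : ZMod 5, (j = i ∨ j = i + 1 ∨ i = j + 1) ∨ j = i + 2 * 1 ∨ j = i + 2 * (-1) := by
  decide

lemma Pent.lab_pair (hx : Pent G S x) (hG : Good G) {v : V} {i j : ZMod 5}
    (hi : Lab G S x v i) (hj : Lab G S x v j) : j = i ∨ j = i + 1 ∨ i = j + 1 := by
  by_contra hcon
  have hd : ∃ d : ZMod 5, (d = 1 ∨ d = -1) ∧ j = i + 2 * d := by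
    rcases z5d i j with h | h | h
    · exact (hcon h).elim
    · exact ⟨1, Or.inl rfl, h⟩
    · exact ⟨-1, Or.inr rfl, h⟩
  obtain ⟨d, hd, rfl⟩ := hd
  obtain ⟨u, hu, hui, hur⟩ := hi
  obtain ⟨w, hw, hwj, hwr⟩ := hj
  let T : Set V := Far G S x ∪ {u, w}
  have hT : Far G S x ⊆ T := Set.subset_union_left
  have hTO : T ⊆ Out S x := by
    rintro a (h | h | h)
    · exact h.1
    · rw [h]; exact hu
    · rw [h]; exact hw
  have hu' := far_rtg hu hur T hT (by simp [T])
  have hw' := far_rtg hw hwr T hT (by simp [T])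
  obtain ⟨k, p, h0, hk, hS, hp, hP, hQ⟩ := shortest G T (fun a => G.Adj a (x i))
    (fun a => G.Adj a (x (i + 2 * d))) (u := u) (v := w) (by simp [T]) hui hwj
    ((rtg_symm hu'.2).trans hw'.2)
  refine hx.f3 hG hp (fun t ht => hTO (hS t ht)) hd h0 hk ?_
  intro t h1 h2 m hm
  rcases hS t h2.le with h | h | h
  · exact h.2 m hm
  · exact hP t h1 h2.le (by rw [h]; exact hui)
  · exact hQ t h2 (by rw [h]; exact hwj)

lemma far_or {v : V} (hv : v ∈ Out S x) : v ∈ Far G S x ∨ ∃ m, G.Adj v (x m) := by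
  by_cases h : ∃ m, G.Adj v (x m)
  · exact Or.inr h
  · push Not at h; exact Or.inl ⟨hv, h⟩

lemma Pent.lab_adj (hx : Pent G S x) (hG : Good G) {u v : V} {i j : ZMod 5} (hu : u ∈ Out S x)
    (hv : v ∈ Out S x) (huv : G.Adj u v)
    (hi : Lab G S x u i) (hj : Lab G S x v j) : j = i ∨ j = i + 1 ∨ i = j + 1 := by
  rcases far_or (G := G) hu with h | ⟨m, hm⟩
  · exact hx.lab_pair hG hi (lab_step h hv huv hj)
  · rcases far_or (G := G) hv with h | ⟨m', hm'⟩
    · exact hx.lab_pair hG (lab_step h hu huv.symm hi) hj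
    · exact (hx.nadj hG hu hv huv hm hm').elim

/-- a path from the neighbours of `x i` to the neighbours of `x (i+2d)` whose inner vertices
are only attached to `x (i+d)` -/
structure Link (G : SimpleGraph V) (S : Set V) (x : ZMod 5 → V) (i d : ZMod 5) (p : ℕ → V)
    (k : ℕ) : Prop where
  ind : IndPath G p k
  out : ∀ t ≤ k, p t ∈ Out S x
  start : G.Adj (p 0) (x i)
  fin : G.Adj (p k) (x (i + 2 * d))
  mid : ∀ t, 0 < t → t < k → ∀ m, G.Adj (p t) (x m) → m = i + d

lemma Link.adj_succ {i d : ZMod 5} {p : ℕ → V} {k : ℕ} (h : Link G S x i d p k) (t : ℕ)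
    (ht : t < k) : G.Adj (p t) (p (t+1)) := ((h.ind t (t+1) (by omega) (by omega)).2).2 rfl

lemma Link.two_le {i d : ZMod 5} {p : ℕ → V} {k : ℕ} (h : Link G S x i d p k) (hx : Pent G S x)
    (hG : Good G) (hd : d = 1 ∨ d = -1) : 2 ≤ k := by
  have hid : ∀ i d : ZMod 5, (d = 1 ∨ d = -1) → i + 2 * d ≠ i := by decide
  have hk0 : k ≠ 0 := by
    rintro rfl
    exact hid i d hd (hx.uniq hG (h.out 0 le_rfl) h.start h.fin)
  have hk1 : k ≠ 1 := by
    rintro rfl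
    exact hx.nadj hG (h.out 0 (by omega)) (h.out 1 le_rfl) (h.adj_succ 0 (by omega)) h.start h.fin
  omega

lemma Link.adj_iff {i d : ZMod 5} {p : ℕ → V} {k : ℕ} (h : Link G S x i d p k) (hx : Pent G S x)
    (hG : Good G) (t : ℕ) (ht : t ≤ k) (m : ZMod 5) (hm : m ≠ i + d) :
      (G.Adj (p t) (x m) ↔ ((t = k ∧ m = i + 2 * d) ∨ (t = 0 ∧ m = i))) := by
  constructor
  · intro h'
    rcases Nat.eq_zero_or_pos t with rfl | h1
    · exact Or.inr ⟨rfl, hx.uniq hG (h.out 0 (by omega)) h.start h'⟩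
    · rcases Nat.lt_or_ge t k with h2 | h2
      · exact (hm (h.mid t h1 h2 m h')).elim
      · obtain rfl : t = k := by omega
        exact Or.inl ⟨rfl, hx.uniq hG (h.out _ le_rfl) h.fin h'⟩
  · rintro (⟨rfl, rfl⟩ | ⟨rfl, rfl⟩)
    · exact h.fin
    · exact h.start

lemma Link.odd {i d : ZMod 5} {p : ℕ → V} {k : ℕ} (h : Link G S x i d p k) (hx : Pent G S x)
    (hG : Good G) (hd : d = 1 ∨ d = -1) : Odd k :=
  hx.odd_len hG h.ind (h.two_le hx hG hd) h.out hd (h.adj_iff hx hG)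

lemma Link.lab_mid {i d : ZMod 5} {p : ℕ → V} {k : ℕ} (h : Link G S x i d p k) (hx : Pent G S x)
    (hG : Good G) (hd : d = 1 ∨ d = -1) (t : ℕ) (h0 : 0 < t) (hk : t < k) :
    Lab G S x (p t) (i + d) := by
  have up : ∀ t, t < k → Lab G S x (p t) i ∨ Lab G S x (p t) (i + d) := by
    intro t
    induction t with
    | zero => intro hk; exact Or.inl (lab_att (h.out 0 (by omega)) h.start)
    | succ t ih =>
      intro hk
      have hO := h.out (t+1) (by omega)
      rcases far_or (G := G) hO with hf | ⟨m, hm⟩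
      · have ha := (h.adj_succ t (by omega)).symm
        exact (ih (by omega)).imp (lab_step hf (h.out t (by omega)) ha)
          (lab_step hf (h.out t (by omega)) ha)
      · right
        rw [← h.mid (t+1) (by omega) hk m hm]
        exact lab_att hO hm
  have down : ∀ s, s < k → Lab G S x (p (k - s)) (i + 2 * d) ∨ Lab G S x (p (k - s)) (i + d) := by
    intro s
    induction s with
    | zero => intro hk; exact Or.inl (lab_att (h.out _ (by omega)) h.fin)
    | succ s ih =>
      intro hk
      have hO := h.out (k - (s+1)) (by omega)
      rcases far_or (G := G) hO with hf | ⟨m, hm⟩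
      · have ha := h.adj_succ (k - (s+1)) (by omega)
        rw [show k - (s+1) + 1 = k - s by omega] at ha
        exact (ih (by omega)).imp (lab_step hf (h.out _ (by omega)) ha)
          (lab_step hf (h.out _ (by omega)) ha)
      · right
        rw [← h.mid (k - (s+1)) (by omega) (by omega) m hm]
        exact lab_att hO hm
  rcases up t hk with h1 | h1
  · have := down (k - t) (by omega)
    rw [show k - (k - t) = t by omega] at this
    rcases this with h2 | h2
    · have h3 := hx.lab_pair hG h1 h2
      have : ∀ i d : ZMod 5, (d = 1 ∨ d = -1) →
        ¬ (i + 2 * d = i ∨ i + 2 * d = i + 1 ∨ i = i + 2 * d + 1) := by decide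
      exact (this i d hd h3).elim
    · exact h2
  · exact h1

lemma Link.far_apart {i d : ZMod 5} {p q : ℕ → V} {k l : ℕ} (hp : Link G S x i d p k)
    (hq : Link G S x i (-d) q l) (hx : Pent G S x) (hG : Good G) (hd : d = 1 ∨ d = -1)
    (t s : ℕ) (ht0 : 0 < t) (ht : t ≤ k) (hs0 : 0 < s) (hs : s ≤ l) :
    p t ≠ q s ∧ ¬ G.Adj (p t) (q s) := by
  have hd' : -d = 1 ∨ -d = -1 := by rcases hd with rfl | rfl <;> simp
  have hpl : ∃ m, Lab G S x (p t) m ∧ (m = i + d ∨ (m = i + 2 * d ∧ G.Adj (p t) (x m))) := by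
    rcases Nat.lt_or_ge t k with h | h
    · exact ⟨_, hp.lab_mid hx hG hd t ht0 h, Or.inl rfl⟩
    · obtain rfl : t = k := by omega
      exact ⟨_, lab_att (hp.out _ ht) hp.fin, Or.inr ⟨rfl, hp.fin⟩⟩
  have hql : ∃ m, Lab G S x (q s) m ∧ (m = i + -d ∨ (m = i + 2 * -d ∧ G.Adj (q s) (x m))) := by
    rcases Nat.lt_or_ge s l with h | h
    · exact ⟨_, hq.lab_mid hx hG hd' s hs0 h, Or.inl rfl⟩
    · obtain rfl : s = l := by omega
      exact ⟨_, lab_att (hq.out _ hs) hq.fin, Or.inr ⟨rfl, hq.fin⟩⟩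
  obtain ⟨m, hm, hm'⟩ := hpl
  obtain ⟨n, hn, hn'⟩ := hql
  have z1 : ∀ i d : ZMod 5, (d = 1 ∨ d = -1) → ∀ m n : ZMod 5, (m = i + d ∨ m = i + 2 * d) →
    (n = i + -d ∨ n = i + 2 * -d) → (n = m ∨ n = m + 1 ∨ m = n + 1) →
    (m = i + 2 * d ∧ n = i + 2 * -d ∧ m ≠ i + d ∧ n ≠ i + -d ∧ n ≠ m) := by decide
  have z2 : (n = m ∨ n = m + 1 ∨ m = n + 1) →
      G.Adj (p t) (x m) ∧ G.Adj (q s) (x n) ∧ n ≠ m := by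
    intro h
    obtain ⟨-, -, h3, h4, h5⟩ := z1 i d hd m n (hm'.imp id And.left) (hn'.imp id And.left) h
    exact ⟨(hm'.resolve_left h3).2, (hn'.resolve_left h4).2, h5⟩
  constructor
  · intro h
    obtain ⟨h1, h2, h3⟩ := z2 (hx.lab_pair hG hm (h ▸ hn))
    rw [← h] at h2
    exact h3 (hx.uniq hG (hp.out t ht) h1 h2)
  · intro h
    obtain ⟨h1, h2, h3⟩ := z2 (hx.lab_adj hG (hp.out t ht) (hq.out s hs) h hm hn)
    exact hx.nadj hG (hp.out t ht) (hq.out s hs) h h1 h2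

lemma Link.core {i d : ZMod 5} {p q : ℕ → V} {k l : ℕ} (hp : Link G S x i d p k)
    (hq : Link G S x i (-d) q l) (hx : Pent G S x) (hG : Good G) (hd : d = 1 ∨ d = -1)
    (h0 : p 0 = q 0) : False := by
  have hd' : -d = 1 ∨ -d = -1 := by rcases hd with rfl | rfl <;> simp
  have hk2 := hp.two_le hx hG hd
  have hl2 := hq.two_le hx hG hd'
  have hko := hp.odd hx hG hd
  have hlo := hq.odd hx hG hd'
  obtain ⟨k, rfl⟩ : ∃ k', k = k' + 1 := ⟨k - 1, by omega⟩
  have hJ := hq.ind.rev.join hp.ind.tail (by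
    intro t s ht hs
    rcases Nat.lt_or_ge t l with h | h
    · have := hp.far_apart hq hx hG hd (s+1) (l - t) (by omega) (by omega) (by omega) (by omega)
      refine ⟨this.1.symm, fun h' => (this.2 h'.symm).elim, fun h' => by omega⟩
    · obtain rfl : t = l := by omega
      have := hp.ind 0 (s+1) (by omega) (by omega)
      rw [Nat.sub_self, ← h0]
      refine ⟨this.1, ?_⟩
      rw [this.2]; omega)
  refine hG.hole (l + 1 + k + 1 + 2) _ ?_ (by omega)
    (two_close hJ ((hx.arc (i + 2*d) d hd).mono (by omega : 1 ≤ 3)) (by omega) ?_)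
  · obtain ⟨a, ha⟩ := hko
    obtain ⟨b, hb⟩ := hlo
    exact ⟨a + b + 2, by omega⟩
  · intro T s hT hs
    have z : ∀ i d : ZMod 5, (d = 1 ∨ d = -1) → ∀ s : ℕ, s ≤ 1 →
      ((i + 2 * d + (s : ZMod 5) * d ≠ i + d) ∧ (i + 2 * d + (s : ZMod 5) * d ≠ i + -d) ∧
       (i + 2 * d + (s : ZMod 5) * d = i + 2 * d ↔ s = 0) ∧
       (i + 2 * d + (s : ZMod 5) * d = i + 2 * -d ↔ s = 1) ∧
       (i + 2 * d + (s : ZMod 5) * d ≠ i)) := by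
      decide
    obtain ⟨z1, z2, z3, z4, z5⟩ := z i d hd s hs
    by_cases h : T ≤ l
    · simp only [h, if_true]
      refine ⟨(hq.out _ (by omega)).2 _, ?_⟩
      rw [hq.adj_iff hx hG _ (by omega) _ z2, z4]
      simp only [z5, and_false, or_false]
      omega
    · simp only [h, if_false]
      refine ⟨(hp.out _ (by omega)).2 _, ?_⟩
      rw [hp.adj_iff hx hG _ (by omega) _ z1, z3]
      simp only [z5, and_false, or_false]
      omega

lemma Link.start_ne {i d : ZMod 5} {p q : ℕ → V} {k l : ℕ} (hp : Link G S x i d p k)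
    (hq : Link G S x i (-d) q l) (hx : Pent G S x) (hG : Good G) (hd : d = 1 ∨ d = -1)
    (s : ℕ) (hs0 : 0 < s) (hs : s ≤ l) : p 0 ≠ q s := by
  intro h
  have h1 := hp.start
  rw [h] at h1
  have z : ∀ i d : ZMod 5, (d = 1 ∨ d = -1) → i ≠ i + -d ∧ i ≠ i + 2 * -d := by decide
  rw [hq.adj_iff hx hG s hs _ (z i d hd).1] at h1
  rcases h1 with h1 | h1
  · exact (z i d hd).2 h1.2
  · omega

lemma Link.core2 {i d : ZMod 5} {p q : ℕ → V} {k l : ℕ} (hp : Link G S x i d p k)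
    (hq : Link G S x i (-d) q l) (hx : Pent G S x) (hG : Good G) (hd : d = 1 ∨ d = -1)
    (h0 : p 0 ≠ q 0) (h1 : ∀ s, 0 < s → s ≤ l → ¬ G.Adj (p 0) (q s))
    (h2 : ∀ t, 0 < t → t ≤ k → ¬ G.Adj (q 0) (p t)) : False := by
  have hd' : -d = 1 ∨ -d = -1 := by rcases hd with rfl | rfl <;> simp
  have hk2 := hp.two_le hx hG hd
  have hl2 := hq.two_le hx hG hd'
  have hko := hp.odd hx hG hd
  have hlo := hq.odd hx hG hd'
  have hq' : Link G S x i (- -d) p k := by rwa [neg_neg]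
  have zi : ∀ i d : ZMod 5, (d = 1 ∨ d = -1) →
    i ≠ i + d ∧ i ≠ i + -d ∧ i ≠ i + 2 * d ∧ i ≠ i + 2 * -d := by decide
  obtain ⟨y1, y2, y3, y4⟩ := zi i d hd
  have hpq : ∀ t s, t ≤ k → s ≤ l → p t ≠ q s ∧ ¬ G.Adj (p t) (q s) := by
    intro t s ht hs
    rcases Nat.eq_zero_or_pos t with rfl | ht0
    · rcases Nat.eq_zero_or_pos s with rfl | hs0
      · exact ⟨h0, fun h => hx.nadj hG (hp.out 0 (by omega)) (hq.out 0 (by omega)) h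
          hp.start hq.start⟩
      · exact ⟨hp.start_ne hq hx hG hd s hs0 hs, h1 s hs0 hs⟩
    · rcases Nat.eq_zero_or_pos s with rfl | hs0
      · exact ⟨(hq.start_ne hq' hx hG hd' t ht0 ht).symm, fun h => h2 t ht0 ht h.symm⟩
      · exact hp.far_apart hq hx hG hd t s ht0 ht hs0 hs
  have hI : IndPath G (fun _ => x i) 0 := by
    intro a b hab hb; omega
  have hK := hI.join hp.ind (by
    intro a b ha hb
    refine ⟨((hp.out b hb).2 _).symm, ?_⟩
    rw [G.adj_comm, hp.adj_iff hx hG b hb _ y1]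
    simp only [y3, and_false, false_or, and_true]
    omega)
  have hJ := hq.ind.rev.join hK (by
    intro t s ht hs
    by_cases h : s ≤ 0
    · simp only [h, if_true]
      refine ⟨(hq.out _ (by omega)).2 _, ?_⟩
      rw [hq.adj_iff hx hG _ (by omega) _ y2]
      simp only [y4, and_false, false_or, and_true]
      omega
    · simp only [h, if_false]
      have := hpq (s - (0+1)) (l - t) (by omega) (by omega)
      exact ⟨this.1.symm, fun h' => (this.2 h'.symm).elim, fun h' => by omega⟩)
  refine hG.hole (l + 1 + (0 + 1 + k) + 1 + 2) _ ?_ (by omega)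
    (two_close hJ ((hx.arc (i + 2*d) d hd).mono (by omega : 1 ≤ 3)) (by omega) ?_)
  · obtain ⟨a, ha⟩ := hko
    obtain ⟨b, hb⟩ := hlo
    exact ⟨a + b + 3 , by omega⟩
  · intro T s hT hs
    have z : ∀ i d : ZMod 5, (d = 1 ∨ d = -1) → ∀ s : ℕ, s ≤ 1 →
      ((i + 2 * d + (s : ZMod 5) * d ≠ i + d) ∧ (i + 2 * d + (s : ZMod 5) * d ≠ i + -d) ∧
       (i + 2 * d + (s : ZMod 5) * d = i + 2 * d ↔ s = 0) ∧
       (i + 2 * d + (s : ZMod 5) * d = i + 2 * -d ↔ s = 1) ∧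
       (i + 2 * d + (s : ZMod 5) * d ≠ i) ∧
       ¬ (i + 2 * d + (s : ZMod 5) * d = i + 1 ∨ i = i + 2 * d + (s : ZMod 5) * d + 1)) := by
      decide
    obtain ⟨z1, z2, z3, z4, z5, z6⟩ := z i d hd s hs
    by_cases h : T ≤ l
    · simp only [h, if_true]
      refine ⟨(hq.out _ (by omega)).2 _, ?_⟩
      rw [hq.adj_iff hx hG _ (by omega) _ z2, z4]
      simp only [z5, and_false, or_false]
      omega
    · simp only [h, if_false]
      by_cases h' : T - (l+1) ≤ 0
      · simp only [h', if_true]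
        refine ⟨fun h => z5 (hx.inj _ _ h).symm, ?_⟩
        rw [hx.adj]
        simp only [z6, false_iff]
        omega
      · simp only [h', if_false]
        refine ⟨(hp.out _ (by omega)).2 _, ?_⟩
        rw [hp.adj_iff hx hG _ (by omega) _ z1, z3]
        simp only [z5, and_false, or_false]
        omega

lemma Link.repl {i d : ZMod 5} {q : ℕ → V} {l : ℕ} (hq : Link G S x i d q l)
    {u : V} (hu : u ∈ Out S x) (hui : G.Adj u (x i)) {s : ℕ} (hs0 : 0 < s) (hs : s ≤ l)
    (hus : G.Adj u (q s)) : ∃ q' l', Link G S x i d q' l' ∧ q' 0 = u := by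
  let T : Set V := {v | v = u ∨ ∃ t, 0 < t ∧ t ≤ l ∧ v = q t}
  have hTq : ∀ t, 0 < t → t ≤ l → q t ∈ T := fun t h1 h2 => Or.inr ⟨t, h1, h2, rfl⟩
  have hr : ∀ r, s ≤ r → r ≤ l →
      Relation.ReflTransGen (fun a b => G.Adj a b ∧ a ∈ T ∧ b ∈ T) u (q r) := by
    intro r hr
    induction r, hr using Nat.le_induction with
    | base => intro _; exact Relation.ReflTransGen.single ⟨hus, Or.inl rfl, hTq s hs0 hs⟩
    | succ r hr ih =>
      intro hrl
      exact (ih (by omega)).tail ⟨hq.adj_succ r (by omega), hTq r (by omega) (by omega),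
        hTq (r+1) (by omega) hrl⟩
  obtain ⟨k, p, h0, hk, hS, hp, hP, hQ⟩ := shortest G T (fun a => a = u)
    (fun a => G.Adj a (x (i + 2 * d))) (u := u) (v := q l) (Or.inl rfl) rfl hq.fin (hr l hs le_rfl)
  refine ⟨p, k, ⟨hp, ?_, by rw [h0]; exact hui, hk, ?_⟩, h0⟩
  · intro t ht
    rcases hS t ht with h | ⟨r, _, hr, h⟩
    · rw [h]; exact hu
    · rw [h]; exact hq.out r hr
  · intro t h1 h2 m hm
    rcases hS t h2.le with h | ⟨r, hr0, hr, h⟩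
    · exact (hP t h1 h2.le h).elim
    · refine hq.mid r hr0 ?_ m (h ▸ hm)
      rcases Nat.lt_or_ge r l with h' | h'
      · exact h'
      · obtain rfl : r = l := by omega
        exact (hQ t h2 (h ▸ hq.fin)).elim

lemma Link.conflict {i d : ZMod 5} {p q : ℕ → V} {k l : ℕ} (hp : Link G S x i d p k)
    (hq : Link G S x i (-d) q l) (hx : Pent G S x) (hG : Good G) (hd : d = 1 ∨ d = -1) : False := by
  by_cases h0 : p 0 = q 0
  · exact hp.core hq hx hG hd h0
  by_cases h1 : ∃ s, 0 < s ∧ s ≤ l ∧ G.Adj (p 0) (q s)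
  · obtain ⟨s, hs0, hs, h⟩ := h1
    obtain ⟨q', l', hq', h'⟩ := hq.repl (hp.out 0 (by omega)) hp.start hs0 hs h
    exact hp.core hq' hx hG hd h'.symm
  by_cases h2 : ∃ t, 0 < t ∧ t ≤ k ∧ G.Adj (q 0) (p t)
  · obtain ⟨s, hs0, hs, h⟩ := h2
    obtain ⟨p', k', hp', h'⟩ := hp.repl (hq.out 0 (by omega)) hq.start hs0 hs h
    exact hp'.core hq hx hG hd h'
  · push Not at h1 h2
    exact hp.core2 hq hx hG hd h0 h1 h2

lemma Link.rev {i d : ZMod 5} {p : ℕ → V} {k : ℕ} (hp : Link G S x i d p k) :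
    Link G S x (i + 2 * d) (-d) (fun t => p (k - t)) k := by
  refine ⟨hp.ind.rev, fun t ht => hp.out _ (by omega), by simpa using hp.fin, ?_, ?_⟩
  · simpa using hp.start
  · intro t h1 h2 m hm
    rw [hp.mid (k - t) (by omega) (by omega) m hm]; ring

/-- there is a link with centre `c` -/
def HasLink (G : SimpleGraph V) (S : Set V) (x : ZMod 5 → V) (c : ZMod 5) : Prop :=
  ∃ p k, Link G S x (c - 1) 1 p k

lemma HasLink.of {i d : ZMod 5} {p : ℕ → V} {k : ℕ} (hp : Link G S x i d p k)
    (hd : d = 1 ∨ d = -1) : HasLink G S x (i + d) := by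
  rcases hd with rfl | rfl
  · exact ⟨p, k, by simpa using hp⟩
  · refine ⟨fun t => p (k - t), k, ?_⟩
    have := hp.rev
    rw [neg_neg, show i + 2 * -1 = i + -1 - 1 by ring] at this
    exact this

lemma HasLink.conflict {c : ZMod 5} (hx : Pent G S x) (hG : Good G) (h1 : HasLink G S x c)
    (h2 : HasLink G S x (c + 2)) : False := by
  obtain ⟨p, k, hp⟩ := h1
  obtain ⟨q, l, hq⟩ := h2
  have hp' := hp.rev
  rw [show c - 1 + 2 * 1 = c + 1 by ring] at hp'
  rw [show c + 2 - 1 = c + 1 by ring] at hq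
  exact hq.conflict hp' hx hG (Or.inl rfl)

/-- reachability outside the pentagon -/
def Comp (G : SimpleGraph V) (S : Set V) (x : ZMod 5 → V) (a : V) : Set V :=
  {v | Relation.ReflTransGen (fun a b => G.Adj a b ∧ a ∈ Out S x ∧ b ∈ Out S x) a v}

lemma comp_out {a v : V} (ha : a ∈ Out S x) (hv : v ∈ Comp G S x a) : v ∈ Out S x := by
  rcases Relation.ReflTransGen.cases_tail hv with h | ⟨c, -, hc⟩
  · rw [h]; exact ha
  · exact hc.2.2

lemma comp_rtg {a u v : V} (hu : u ∈ Comp G S x a)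
    (h : Relation.ReflTransGen (fun a b => G.Adj a b ∧ a ∈ Out S x ∧ b ∈ Out S x) u v) :
    v ∈ Comp G S x a ∧
    Relation.ReflTransGen (fun b c => G.Adj b c ∧ b ∈ Comp G S x a ∧ c ∈ Comp G S x a) u v := by
  induction h with
  | refl => exact ⟨hu, Relation.ReflTransGen.refl⟩
  | tail _ hbc ih =>
    have : _ ∈ Comp G S x a := Relation.ReflTransGen.tail ih.1 hbc
    exact ⟨this, ih.2.tail ⟨hbc.1, ih.1, this⟩⟩

lemma exists_link (hx : Pent G S x) (hG : Good G) {a : V} (ha : a ∈ Out S x) {j : ZMod 5}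
    (haj : G.Adj a (x j)) (h : ∃ u v m n, u ∈ Comp G S x a ∧ v ∈ Comp G S x a ∧ G.Adj u (x m) ∧
      G.Adj v (x n) ∧ ¬ (n = m ∨ n = m + 1 ∨ m = n + 1)) :
    HasLink G S x (j - 1) ∨ HasLink G S x j ∨ HasLink G S x (j + 1) := by
  by_cases hc : ∃ u, u ∈ Comp G S x a ∧ (G.Adj u (x (j + 2 * 1)) ∨ G.Adj u (x (j + 2 * -1)))
  · obtain ⟨u, hu, hu2⟩ := hc
    obtain ⟨k, p, h0, hk, hS, hp, hP, hQ⟩ := shortest G (Out S x) (fun a => G.Adj a (x j))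
      (fun a => G.Adj a (x (j + 2 * 1)) ∨ G.Adj a (x (j + 2 * -1))) ha haj hu2 hu
    have hd : ∃ d : ZMod 5, (d = 1 ∨ d = -1) ∧ G.Adj (p k) (x (j + 2 * d)) := by
      rcases hk with hk | hk
      · exact ⟨1, Or.inl rfl, hk⟩
      · exact ⟨-1, Or.inr rfl, hk⟩
    obtain ⟨d, hd, hk'⟩ := hd
    have hmid : ∀ t, 0 < t → t < k → ∀ m, G.Adj (p t) (x m) → m = j + d ∨ m = j + -d := by
      intro t h1 h2 m hm
      have e1 : m ≠ j := by rintro rfl; exact hP t h1 h2.le hm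
      have e2 : m ≠ j + 2 * 1 := by rintro rfl; exact hQ t h2 (Or.inl hm)
      have e3 : m ≠ j + 2 * -1 := by rintro rfl; exact hQ t h2 (Or.inr hm)
      have z : ∀ j m : ZMod 5, m = j ∨ m = j + 2 * 1 ∨ m = j + 2 * -1 ∨ m = j + 1 ∨ m = j + -1 := by
        decide
      rcases z j m with h | h | h | h | h
      · exact (e1 h).elim
      · exact (e2 h).elim
      · exact (e3 h).elim
      · rcases hd with rfl | rfl
        · exact Or.inl h
        · exact Or.inr (by rw [neg_neg]; exact h)
      · rcases hd with rfl | rfl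
        · exact Or.inr h
        · exact Or.inl h
    have zz : ∀ j d : ZMod 5, (d = 1 ∨ d = -1) →
      ¬ (j + 2 * d = j + -d ∨ j + 2 * d = j + -d + 1 ∨ j + -d = j + 2 * d + 1) ∧
      ¬ (j + d = j + -d ∨ j + d = j + -d + 1 ∨ j + -d = j + d + 1) := by decide
    have down : ∀ s, s < k → Lab G S x (p (k - s)) (j + 2 * d) ∨
        Lab G S x (p (k - s)) (j + d) := by
      intro s
      induction s with
      | zero => intro hk; exact Or.inl (lab_att (hS _ (by omega)) hk')
      | succ s ih =>
        intro hsk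
        have hO := hS (k - (s+1)) (by omega)
        have hO' := hS (k - s) (by omega)
        have ha : G.Adj (p (k - (s+1))) (p (k - s)) :=
          ((hp (k - (s+1)) (k - s) (by omega) (by omega)).2).2 (by omega)
        rcases far_or (G := G) hO with hf | ⟨m, hm⟩
        · exact (ih (by omega)).imp (lab_step hf hO' ha) (lab_step hf hO' ha)
        · rcases hmid _ (by omega) (by omega) m hm with rfl | rfl
          · exact Or.inr (lab_att hO hm)
          · rcases ih (by omega) with h | h
            · exact ((zz j d hd).1 (hx.lab_adj hG hO hO' ha (lab_att hO hm) h)).elim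
            · exact ((zz j d hd).2 (hx.lab_adj hG hO hO' ha (lab_att hO hm) h)).elim
    have hL : Link G S x j d p k := by
      refine ⟨hp, hS, h0, hk', ?_⟩
      intro t h1 h2 m hm
      rcases hmid t h1 h2 m hm with h | h
      · exact h
      · subst h
        have := down (k - t) (by omega)
        rw [show k - (k - t) = t by omega] at this
        rcases this with h | h
        · exact ((zz j d hd).1 (Or.inl (hx.lab_of_att hG (hS t h2.le) hm h))).elim
        · exact ((zz j d hd).2 (Or.inl (hx.lab_of_att hG (hS t h2.le) hm h))).elim
    have := HasLink.of hL hd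
    rcases hd with rfl | rfl
    · exact Or.inr (Or.inr this)
    · exact Or.inl (by rwa [sub_eq_add_neg])
  · push Not at hc
    have z : ∀ j m : ZMod 5, m ≠ j + 2 * 1 → m ≠ j + 2 * -1 → (m = j ∨ m = j + -1 ∨ m = j + 1) := by
      decide
    have hm : ∀ u ∈ Comp G S x a, ∀ m, G.Adj u (x m) → (m = j ∨ m = j + -1 ∨ m = j + 1) := by
      intro u hu m hm
      refine z j m ?_ ?_
      · rintro rfl; exact (hc u hu).1 hm
      · rintro rfl; exact (hc u hu).2 hm
    have huv : ∃ u v, u ∈ Comp G S x a ∧ v ∈ Comp G S x a ∧ G.Adj u (x (j + -1)) ∧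
        G.Adj v (x (j + 1)) := by
      obtain ⟨u, v, m, n, hu, hv, hum, hvn, hmn⟩ := h
      have z2 : ∀ j m n : ZMod 5, (m = j ∨ m = j + -1 ∨ m = j + 1) →
        (n = j ∨ n = j + -1 ∨ n = j + 1) → ¬ (n = m ∨ n = m + 1 ∨ m = n + 1) →
        (m = j + -1 ∧ n = j + 1) ∨ (n = j + -1 ∧ m = j + 1) := by decide
      rcases z2 j m n (hm u hu m hum) (hm v hv n hvn) hmn with ⟨rfl, rfl⟩ | ⟨rfl, rfl⟩
      · exact ⟨u, v, hu, hv, hum, hvn⟩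
      · exact ⟨v, u, hv, hu, hvn, hum⟩
    obtain ⟨u, v, hu, hv, huj, hvj⟩ := huv
    obtain ⟨k, p, h0, hk, hS, hp, hP, hQ⟩ := shortest G (Comp G S x a)
      (fun a => G.Adj a (x (j + -1))) (fun a => G.Adj a (x (j + 1))) hu huj hvj
      (comp_rtg hu ((rtg_symm hu).trans hv)).2
    right; left
    refine ⟨p, k, hp, fun t ht => comp_out ha (hS t ht), by rwa [sub_eq_add_neg], ?_, ?_⟩
    · rwa [show j - 1 + 2 * 1 = j + 1 by ring]
    · intro t h1 h2 m hmm
      rcases hm _ (hS t h2.le) m hmm with rfl | rfl | rfl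
      · ring
      · exact (hP t h1 h2.le hmm).elim
      · exact (hQ t h2 hmm).elim

/-- `S` induces a 3-colourable subgraph -/
def Col (G : SimpleGraph V) (S : Set V) : Prop :=
  ∃ f : V → Fin 3, ∀ u ∈ S, ∀ v ∈ S, G.Adj u v → f u ≠ f v

lemma out_or {v : V} (hv : v ∈ S) : v ∈ Out S x ∨ ∃ m, v = x m := by
  by_cases h : ∃ m, v = x m
  · exact Or.inr h
  · push Not at h; exact Or.inl ⟨hv, h⟩

lemma exists_att (hx : Pent G S x) (hmin : ∀ T, T ⊂ S → Col G T) (hS : ¬ Col G S) (j : ZMod 5) :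
    ∃ a ∈ Out S x, G.Adj a (x j) := by
  classical
  by_contra hno
  push Not at hno
  obtain ⟨f, hf⟩ := hmin (S \ {x j}) ⟨Set.sdiff_subset, fun h => (h (hx.mem j)).2 rfl⟩
  have hc : ∀ a b : Fin 3, ∃ c, c ≠ a ∧ c ≠ b := by decide
  obtain ⟨c, hc1, hc2⟩ := hc (f (x (j+1))) (f (x (j-1)))
  have key : ∀ v ∈ S, G.Adj (x j) v → c ≠ f v := by
    intro v hv hadj
    rcases out_or (x := x) hv with h | ⟨m, rfl⟩
    · exact (hno v h hadj.symm).elim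
    · rcases (hx.adj _ _).1 hadj with rfl | h
      · exact hc1
      · rw [show m = j - 1 by rw [h]; ring]; exact hc2
  refine hS ⟨fun v => if v = x j then c else f v, ?_⟩
  intro u hu v hv huv
  by_cases h1 : u = x j
  · subst h1
    have h2 : v ≠ x j := huv.ne'
    simpa [h2] using key v hv huv
  · by_cases h2 : v = x j
    · subst h2
      simpa [h1] using (key u hu huv.symm).symm
    · simpa [h1, h2] using hf u ⟨hu, h1⟩ v ⟨hv, h2⟩ huv

lemma exists_pair (hx : Pent G S x) (hmin : ∀ T, T ⊂ S → Col G T) (hS : ¬ Col G S) {a : V}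
    (ha : a ∈ Out S x) :
    ∃ u v m n, u ∈ Comp G S x a ∧ v ∈ Comp G S x a ∧ G.Adj u (x m) ∧
      G.Adj v (x n) ∧ ¬ (n = m ∨ n = m + 1 ∨ m = n + 1) := by
  classical
  by_contra hno
  have hno' : ∀ u v m n, u ∈ Comp G S x a → v ∈ Comp G S x a → G.Adj u (x m) →
      G.Adj v (x n) → (n = m ∨ n = m + 1 ∨ m = n + 1) := by
    intro u v m n h1 h2 h3 h4
    by_contra h
    exact hno ⟨u, v, m, n, h1, h2, h3, h4, h⟩
  have hi : ∃ i, ∀ u ∈ Comp G S x a, ∀ m, G.Adj u (x m) → m = i ∨ m = i + 1 := by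
    by_cases h : ∃ u ∈ Comp G S x a, ∃ m, G.Adj u (x m)
    · obtain ⟨u, hu, m, hum⟩ := h
      by_cases h' : ∃ v ∈ Comp G S x a, G.Adj v (x (m+1))
      · obtain ⟨v, hv, hvm⟩ := h'
        refine ⟨m, fun w hw n hwn => ?_⟩
        have z : ∀ m n : ZMod 5, (n = m ∨ n = m + 1 ∨ m = n + 1) →
          (n = m + 1 ∨ n = m + 1 + 1 ∨ m + 1 = n + 1) → n = m ∨ n = m + 1 := by decide
        exact z m n (hno' u w m n hu hw hum hwn) (hno' v w _ n hv hw hvm hwn)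
      · refine ⟨m - 1, fun w hw n hwn => ?_⟩
        have z : ∀ m n : ZMod 5, (n = m ∨ n = m + 1 ∨ m = n + 1) →
          n ≠ m + 1 → n = m - 1 ∨ n = m - 1 + 1 := by decide
        refine z m n (hno' u w m n hu hw hum hwn) ?_
        rintro rfl
        exact h' ⟨w, hw, hwn⟩
    · exact ⟨0, fun u hu m hm => (h ⟨u, hu, m, hm⟩).elim⟩
  obtain ⟨i, hi⟩ := hi
  have hD : ∀ v ∈ Comp G S x a, v ∈ Out S x := fun v hv => comp_out ha hv
  have haD : a ∈ Comp G S x a := Relation.ReflTransGen.refl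
  obtain ⟨f, hf⟩ := hmin (S \ Comp G S x a) ⟨Set.sdiff_subset, fun h => (h ha.1).2 haD⟩
  obtain ⟨g, hg⟩ := hmin (Comp G S x a ∪ {x i, x (i+1)}) ⟨by
      rintro v (h | h | h)
      · exact (hD v h).1
      · rw [h]; exact hx.mem _
      · rw [h]; exact hx.mem _, fun h => by
      have z : ∀ i : ZMod 5, i + 2 ≠ i ∧ i + 2 ≠ i + 1 := by decide
      rcases h (hx.mem (i+2)) with h | h | h
      · exact (hD _ h).2 _ rfl
      · exact (z i).1 (hx.inj _ _ h)
      · exact (z i).2 (hx.inj _ _ h)⟩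
  have hxadj : G.Adj (x i) (x (i+1)) := (hx.adj _ _).2 (Or.inl rfl)
  have hxD : ∀ m, x m ∉ Comp G S x a := fun m h => (hD _ h).2 m rfl
  have hf1 := hf (x i) ⟨hx.mem _, hxD _⟩ (x (i+1)) ⟨hx.mem _, hxD _⟩ hxadj
  have hg1 := hg (x i) (by simp) (x (i+1)) (by simp) hxadj
  have hperm : ∀ a b c d : Fin 3, a ≠ b → c ≠ d →
      ∃ σ : Equiv.Perm (Fin 3), σ a = c ∧ σ b = d := by decide
  obtain ⟨σ, hσ1, hσ2⟩ := hperm _ _ _ _ hg1 hf1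
  have key : ∀ u ∈ Comp G S x a, ∀ v ∈ S, v ∉ Comp G S x a → G.Adj u v → σ (g u) ≠ f v := by
    intro u hu v hv hvD huv
    rcases out_or (x := x) hv with h | ⟨m, rfl⟩
    · exact (hvD (Relation.ReflTransGen.tail hu ⟨huv, hD u hu, h⟩)).elim
    · rcases hi u hu m huv with rfl | rfl
      · rw [← hσ1]
        exact fun h => hg u (Or.inl hu) _ (by simp) huv (σ.injective h)
      · rw [← hσ2]
        exact fun h => hg u (Or.inl hu) _ (by simp) huv (σ.injective h)
  refine hS ⟨fun v => if v ∈ Comp G S x a then σ (g v) else f v, ?_⟩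
  intro u hu v hv huv
  by_cases h1 : u ∈ Comp G S x a
  · by_cases h2 : v ∈ Comp G S x a
    · simpa [h1, h2] using hg u (Or.inl h1) v (Or.inl h2) huv
    · simpa [h1, h2] using key u h1 v hv h2 huv
  · by_cases h2 : v ∈ Comp G S x a
    · simpa [h1, h2] using (key v h2 u hu h1 huv.symm).symm
    · simpa [h1, h2] using hf u ⟨hu, h1⟩ v ⟨hv, h2⟩ huv

lemma no_pent (hx : Pent G S x) (hG : Good G) (hmin : ∀ T, T ⊂ S → Col G T)
    (hS : ¬ Col G S) : False := by
  have hL : ∀ j, HasLink G S x (j - 1) ∨ HasLink G S x j ∨ HasLink G S x (j + 1) := by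
    intro j
    obtain ⟨a, ha, haj⟩ := exists_att hx hmin hS j
    exact exists_link hx hG ha haj (exists_pair hx hmin hS ha)
  have hne : ∃ c, HasLink G S x c := by
    rcases hL 0 with h | h | h <;> exact ⟨_, h⟩
  obtain ⟨c, hc⟩ := hne
  have n2 : ¬ HasLink G S x (c + 2) := fun h => hc.conflict hx hG h
  have n3 : ¬ HasLink G S x (c + 3) := fun h => h.conflict hx hG (by
    have z3 : ∀ c : ZMod 5, c + 3 + 2 = c := by decide
    rw [z3]; exact hc)
  have h1 : HasLink G S x (c + 1) := by
    rcases hL (c + 2) with h | h | h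
    · rwa [show c + 2 - 1 = c + 1 by ring] at h
    · exact (n2 h).elim
    · rw [show c + 2 + 1 = c + 3 by ring] at h
      exact (n3 h).elim
  have h4 : HasLink G S x (c + 4) := by
    rcases hL (c + 3) with h | h | h
    · rw [show c + 3 - 1 = c + 2 by ring] at h
      exact (n2 h).elim
    · exact (n3 h).elim
    · rwa [show c + 3 + 1 = c + 4 by ring] at h
  have z : ∀ c : ZMod 5, c + 4 + 2 = c + 1 := by decide
  exact h4.conflict hx hG (by rw [z]; exact h1)

lemma exists_pent (hG : Good G) (hS : ¬ Col G S) : ∃ x : ZMod 5 → V, Pent G S x := by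
  have h2 : ¬ (G.induce S).Colorable 2 := by
    intro h
    obtain ⟨f⟩ := h.mono (by norm_num : 2 ≤ 3)
    classical
    refine hS ⟨fun v => if h : v ∈ S then f ⟨v, h⟩ else 0, ?_⟩
    intro u hu v hv huv
    simp only [hu, hv, dif_pos]
    exact f.valid (show (G.induce S).Adj ⟨u, hu⟩ ⟨v, hv⟩ from huv)
  rw [two_colorable_iff_forall_loop_even] at h2
  push Not at h2
  obtain ⟨u, w, hw⟩ := h2
  obtain ⟨n, c, hodd, hn, hc, hcS⟩ := odd_indcyc G S ⟨w.length, fun t => (w.getVert t).1,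
    by simpa using hw, by simp, fun t ht => w.adj_getVert_succ ht, fun t _ => (w.getVert t).2⟩
  have hn5 : n = 5 := by
    by_contra h5
    have h7 : n = 3 ∨ 7 ≤ n := by
      rcases hodd with ⟨r, rfl⟩; omega
    rcases h7 with rfl | h7
    · exact hG.tri (c 0) (c 1) (c 2) (((hc 0 1 (by omega) (by omega)).2).2 (by omega))
        (((hc 1 2 (by omega) (by omega)).2).2 (by omega))
        (((hc 0 2 (by omega) (by omega)).2).2 (by omega)).symm
    · exact hG.hole n c hodd h7 hc
  subst hn5
  have hval : ∀ i : ZMod 5, i.val < 5 := fun i => ZMod.val_lt i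
  have z : ∀ i j : ZMod 5, i.val < j.val →
    ((j.val = i.val + 1 ∨ (i.val = 0 ∧ j.val + 1 = 5)) ↔ (j = i + 1 ∨ i = j + 1)) := by decide
  refine ⟨fun i => c i.val, ?_, ?_, fun i => hcS _ (hval i).le⟩
  · intro i j h
    rcases lt_trichotomy i.val j.val with h' | h' | h'
    · exact ((hc _ _ h' (hval j)).1 h).elim
    · exact ZMod.val_injective 5 h'
    · exact ((hc _ _ h' (hval i)).1 h.symm).elim
  · intro i j
    rcases lt_trichotomy i.val j.val with h' | h' | h'
    · rw [(hc _ _ h' (hval j)).2, z i j h']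
    · obtain rfl := ZMod.val_injective 5 h'
      have : ∀ i : ZMod 5, ¬ (i = i + 1 ∨ i = i + 1) := by decide
      simp only [this i, SimpleGraph.irrefl]
    · rw [G.adj_comm, (hc _ _ h' (hval i)).2, z j i h', or_comm]

end

/-- if `G ∈ 𝒢₂` and no two distinct 5-cycles of `G` share an edge
(two cycles being equal when they have the same edges), then `χ(G) ≤ 3`. -/
theorem stmt_8 {V : Type*} [Fintype V] (G : SimpleGraph V) (hG : G.MemGFamily 2)
    (h5 : ∀ (v₁ v₂ : V) (w₁ : G.Walk v₁ v₁) (w₂ : G.Walk v₂ v₂),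
      w₁.IsCycle → w₂.IsCycle → w₁.length = 5 → w₂.length = 5 →
      (∃ e, e ∈ w₁.edges ∧ e ∈ w₂.edges) → (∀ e, e ∈ w₁.edges ↔ e ∈ w₂.edges)) :
    G.chromaticNumber ≤ 3 := by

  have hgood := good_of G hG h5
  have hcol : ∀ S : Set V, Col G S := by
    intro S
    induction S using WellFoundedLT.induction with
    | ind S ih =>
      by_contra hS
      obtain ⟨x, hx⟩ := exists_pent hgood hS
      exact no_pent hx hgood ih hS
  obtain ⟨f, hf⟩ := hcol Set.univ
  have : G.Colorable 3 := ⟨Coloring.mk f (fun {u v} h => hf u trivial v trivial h)⟩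
  exact this.chromaticNumber_le
end
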